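/- arXiv:2411.05896 — 2 statements merged into one kernel-verified Lean document; each statement's English description precedes it below -/
import Mathlib

section
/- Under Assumptions (A) and (C), the N-player game admits a Nash equilibrium α̂ = (α̂^1,…,α̂^N) ∈ 𝒜^N, and this Nash equilibrium is unique, i.e. any two Nash equilibria agree dℙ⊗dt-a.e. on Ω×[0,T] in every component. -/
open MeasureTheory Set Filter

noncomputable section

/-- Inner product on `L²([0,T],ℝ)`. -/
def ip (T : ℝ) (f g : ℝ → ℝ) : ℝ := ∫ t in Icc (0:ℝ) T, f t * g t

/-- Integral operator induced by a kernel `G`. -/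
def opK (T : ℝ) (G : ℝ → ℝ → ℝ) (f : ℝ → ℝ) : ℝ → ℝ :=
  fun t => ∫ s in Icc (0:ℝ) T, G t s * f s

/-- Integral operator induced by the adjoint kernel `G*(t,s) = G(s,t)`. -/
def opKadj (T : ℝ) (G : ℝ → ℝ → ℝ) (f : ℝ → ℝ) : ℝ → ℝ :=
  fun t => ∫ s in Icc (0:ℝ) T, G s t * f s

/-- `G ∈ L²([0,T]²,ℝ)`. -/
def IsL2Kernel (T : ℝ) (G : ℝ → ℝ → ℝ) : Prop :=
  Measurable (Function.uncurry G) ∧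
    Integrable (fun p : ℝ × ℝ => (G p.1 p.2) ^ 2)
      ((volume.restrict (Icc (0:ℝ) T)).prod (volume.restrict (Icc (0:ℝ) T)))

/-- Volterra kernel in `𝒢`: square integrable on `[0,T]²` and vanishing for `s ≥ t`. -/
def IsVolterraKernel (T : ℝ) (G : ℝ → ℝ → ℝ) : Prop :=
  IsL2Kernel T G ∧ ∀ t s : ℝ, t ≤ s → G t s = 0

/-- Membership in `L²([0,T],ℝ)`. -/
def MemL2 (T : ℝ) (f : ℝ → ℝ) : Prop :=
  Measurable f ∧ Integrable (fun t => (f t) ^ 2) (volume.restrict (Icc (0:ℝ) T))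

/-- Membership in `L²([0,T],ℝ^N)`. -/
def MemL2N (T : ℝ) {N : ℕ} (f : ℝ → Fin N → ℝ) : Prop :=
  (∀ i, Measurable fun t => f t i) ∧
    Integrable (fun t => ∑ i, (f t i) ^ 2) (volume.restrict (Icc (0:ℝ) T))

variable {Ω : Type}

/-- Square-integrability of a process on `[0,T] × Ω`. -/
def SqInt (T : ℝ) [MeasurableSpace Ω] (P : Measure Ω) (α : ℝ → Ω → ℝ) : Prop :=
  Integrable (fun p : ℝ × Ω => (α p.1 p.2) ^ 2) ((volume.restrict (Icc (0:ℝ) T)).prod P)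

/-- Admissible control: progressively measurable and square integrable on `[0,T] × Ω`. -/
def Admissible (T : ℝ) {mΩ : MeasurableSpace Ω} (F : Filtration ℝ mΩ) (P : Measure Ω)
    (α : ℝ → Ω → ℝ) : Prop :=
  ProgMeasurable F α ∧ SqInt T P α

/-- Objective functional `J^{i,N}` of player `i` in the finite-player game with
heterogeneous interactions. -/
def Jfin (T : ℝ) {mΩ : MeasurableSpace Ω} (P : Measure Ω) {N : ℕ}
    (B Bbar : Fin N → Fin N → ℝ → ℝ → ℝ) (lam : Fin N → ℝ)
    (C : Fin N → Fin N → Fin N → ℝ → ℝ → ℝ)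
    (b : Fin N → Fin N → ℝ → Ω → ℝ) (c : Fin N → Ω → ℝ)
    (i : Fin N) (α : Fin N → ℝ → Ω → ℝ) : ℝ :=
  ∫ ω,
    (- ip T (fun t => α i t ω)
        (fun t => opK T (B i i) (fun s => α i s ω) t + lam i * α i t ω)
      - ∑ j ∈ Finset.univ.erase i,
          ip T (fun t => α i t ω)
            (fun t => opK T (B i j) (fun s => α j s ω) t
              + opKadj T (Bbar j i) (fun s => α j s ω) t)
      - ∑ j ∈ Finset.univ.erase i, ∑ k ∈ Finset.univ.erase i,
          ip T (fun t => α j t ω) (opK T (C i j k) (fun s => α k s ω))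
      + ip T (fun t => b i i t ω) (fun t => α i t ω)
      + ∑ j ∈ Finset.univ.erase i, ip T (fun t => b i j t ω) (fun t => α j t ω)
      + c i ω) ∂P

/-- Nash equilibrium of the finite-player game. -/
def IsNashFin (T : ℝ) {mΩ : MeasurableSpace Ω} (F : Filtration ℝ mΩ) (P : Measure Ω) {N : ℕ}
    (B Bbar : Fin N → Fin N → ℝ → ℝ → ℝ) (lam : Fin N → ℝ)
    (C : Fin N → Fin N → Fin N → ℝ → ℝ → ℝ)
    (b : Fin N → Fin N → ℝ → Ω → ℝ) (c : Fin N → Ω → ℝ)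
    (α : Fin N → ℝ → Ω → ℝ) : Prop :=
  (∀ i, Admissible T F P (α i)) ∧
    ∀ (i : Fin N) (β : ℝ → Ω → ℝ), Admissible T F P β →
      Jfin T P B Bbar lam C b c i (Function.update α i β) ≤ Jfin T P B Bbar lam C b c i α

theorem abs_exist {H : Type*} [NormedAddCommGroup H] [InnerProductSpace ℝ H] [CompleteSpace H]
    (V : Submodule ℝ H) [CompleteSpace V] {N : ℕ} (M : Fin N → Fin N → H →L[ℝ] H)
    (c₀ : ℝ) (hc₀ : 0 < c₀)
    (hco : ∀ U : Fin N → H, c₀ * ∑ i, inner ℝ (U i) (U i) ≤ ∑ i, ∑ j, inner ℝ (U i) (M i j (U j)))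
    (b : Fin N → V) :
    ∃ U : Fin N → V, ∀ i, ∀ w : V, ∑ j, inner ℝ (w : H) (M i j (U j)) = inner ℝ (b i : H) (w : H) := by
  let E := PiLp 2 (fun _ : Fin N => V)
  let pr : Fin N → E →L[ℝ] H := fun i => V.subtypeL.comp (PiLp.proj 2 (fun _ : Fin N => V) i)
  have hpr : ∀ i (x : E), pr i x = (x i : H) := fun i x => rfl
  let a : E →L[ℝ] E →L[ℝ] ℝ := ∑ i, ∑ j,
    (innerSL ℝ (E := H)).bilinearComp ((M i j).comp (pr j)) (pr i)
  have ha : ∀ x y : E, a x y = ∑ i, ∑ j, inner ℝ (y i : H) (M i j (x j)) := by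
    intro x y
    simp only [a, sum_apply, ContinuousLinearMap.bilinearComp_apply,
      innerSL_apply_apply, ContinuousLinearMap.comp_apply, hpr]
    refine Finset.sum_congr rfl fun i _ => Finset.sum_congr rfl fun j _ => real_inner_comm _ _
  have hcoer : IsCoercive a := by
    refine ⟨c₀, hc₀, fun x => ?_⟩
    rw [ha]
    refine le_trans (le_of_eq ?_) (hco fun i => (x i : H))
    rw [mul_assoc, ← real_inner_self_eq_norm_mul_norm, PiLp.inner_apply]
    rfl
  let e := hcoer.continuousLinearEquivOfBilin
  let b' : E := WithLp.toLp 2 b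
  let U : E := e.symm b'
  have hU : ∀ y : E, a U y = inner ℝ b' y := by
    intro y
    rw [← hcoer.continuousLinearEquivOfBilin_apply U y]
    congr 1
    exact e.apply_symm_apply b'
  refine ⟨fun i => U i, fun i w => ?_⟩
  have h := hU (WithLp.toLp 2 (Pi.single i w))
  rw [ha, PiLp.inner_apply] at h
  rw [Finset.sum_eq_single i (fun j _ hj => by simp [Pi.single_eq_of_ne hj]) (by simp)] at h
  have hsum := h.trans
    (Finset.sum_eq_single i (fun j _ hj => by simp [Pi.single_eq_of_ne hj]) (by simp))
  simpa [b'] using hsum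

/-- abstract objective -/
def JH {H : Type*} [NormedAddCommGroup H] [InnerProductSpace ℝ H] {N : ℕ}
    (K Kb : Fin N → Fin N → H →L[ℝ] H) (lam : Fin N → ℝ)
    (Cc : Fin N → Fin N → Fin N → H →L[ℝ] H) (b : Fin N → Fin N → H) (c : Fin N → ℝ)
    (i : Fin N) (U : Fin N → H) : ℝ :=
  - inner ℝ (U i) (K i i (U i) + lam i • U i)
  - ∑ j ∈ Finset.univ.erase i, inner ℝ (U i) (K i j (U j) + Kb j i (U j))
  - ∑ j ∈ Finset.univ.erase i, ∑ k ∈ Finset.univ.erase i, inner ℝ (U j) (Cc i j k (U k))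
  + inner ℝ (b i i) (U i) + ∑ j ∈ Finset.univ.erase i, inner ℝ (b i j) (U j) + c i

theorem JH_diff {H : Type*} [NormedAddCommGroup H] [InnerProductSpace ℝ H] {N : ℕ}
    (K Kb : Fin N → Fin N → H →L[ℝ] H) (lam : Fin N → ℝ)
    (Cc : Fin N → Fin N → Fin N → H →L[ℝ] H) (b : Fin N → Fin N → H) (c : Fin N → ℝ)
    (hadj : ∀ i u v, inner ℝ u (Kb i i v) = inner ℝ (K i i u) v)
    (i : Fin N) (U : Fin N → H) (d : H) :
    JH K Kb lam Cc b c i (Function.update U i (U i + d)) - JH K Kb lam Cc b c i U =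
    - (∑ j, inner ℝ d (K i j (U j) + Kb j i (U j) + (if i = j then (2 * lam i) • U j else 0))
        - inner ℝ (b i i) d) - (inner ℝ d (K i i d) + lam i * inner ℝ d d) := by
  have e1 : ∀ j ∈ Finset.univ.erase i, Function.update U i (U i + d) j = U j := by
    intro j hj; rw [Function.update_of_ne (Finset.ne_of_mem_erase hj)]
  unfold JH
  rw [Function.update_self]
  rw [Finset.sum_congr rfl (fun j hj => by rw [e1 j hj]) (f := fun j =>
    inner ℝ (U i + d) (K i j (Function.update U i (U i + d) j) +
      Kb j i (Function.update U i (U i + d) j))) (g := fun j =>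
    inner ℝ (U i + d) (K i j (U j) + Kb j i (U j)))]
  rw [Finset.sum_congr rfl (fun j hj => Finset.sum_congr rfl fun k hk => by rw [e1 j hj, e1 k hk])
    (g := fun j => ∑ k ∈ Finset.univ.erase i, inner ℝ (U j) (Cc i j k (U k)))]
  rw [Finset.sum_congr rfl (fun j hj => by rw [e1 j hj]) (f := fun j =>
    inner ℝ (b i j) (Function.update U i (U i + d) j)) (g := fun j =>
    inner ℝ (b i j) (U j))]
  rw [← Finset.add_sum_erase Finset.univ (fun j => inner ℝ d (K i j (U j) + Kb j i (U j) + (if i = j then (2 * lam i) • U j else 0))) (Finset.mem_univ i)]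
  rw [Finset.sum_congr rfl (fun j hj => by rw [if_neg (Finset.ne_of_mem_erase hj).symm, add_zero]) (s₁ := Finset.univ.erase i) (f := fun j => inner ℝ d (K i j (U j) + Kb j i (U j) + (if i = j then (2 * lam i) • U j else 0))) (g := fun j => inner ℝ d (K i j (U j) + Kb j i (U j)))]
  simp only [inner_add_left, if_true, inner_add_right, inner_smul_right, map_add, smul_add, hadj]
  rw [real_inner_comm (K i i d) (U i), real_inner_comm d (U i)]
  simp only [Finset.sum_add_distrib]
  ring

theorem quad_zero {L Q : ℝ} (h : ∀ t : ℝ, - (t * L) - t ^ 2 * Q ≤ 0) : L = 0 := by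
  by_contra hL
  have hQ : 0 < |Q| + 1 := by positivity
  have h2 := h (-(L / (|Q| + 1)))
  have hL2 : 0 < L ^ 2 := by positivity
  have : L ^ 2 / (|Q| + 1) - L ^ 2 / (|Q| + 1) ^ 2 * Q ≤ 0 := by
    refine le_trans (le_of_eq ?_) h2
    field_simp
  have h3 : L ^ 2 / (|Q| + 1) - L ^ 2 / (|Q| + 1) ^ 2 * Q = L ^ 2 * (|Q| + 1 - Q) / (|Q| + 1) ^ 2 := by
    field_simp
  rw [h3] at this
  have : 0 < L ^ 2 * (|Q| + 1 - Q) / (|Q| + 1) ^ 2 := by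
    have := le_abs_self Q
    have : 0 < |Q| + 1 - Q := by linarith
    positivity
  linarith


theorem abs_nash {H : Type*} [NormedAddCommGroup H] [InnerProductSpace ℝ H] [CompleteSpace H]
    (V : Submodule ℝ H) [CompleteSpace V] {N : ℕ}
    (K Kb : Fin N → Fin N → H →L[ℝ] H) (lam : Fin N → ℝ)
    (Cc : Fin N → Fin N → Fin N → H →L[ℝ] H) (b : Fin N → Fin N → H) (c : Fin N → ℝ)
    (hadj : ∀ i u v, inner ℝ u (Kb i i v) = inner ℝ (K i i u) v)
    (c₀ : ℝ) (hc₀ : 0 < c₀)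
    (hco : ∀ U : Fin N → H, c₀ * ∑ i, inner ℝ (U i) (U i) ≤
      ∑ i, inner ℝ (U i) ((∑ j, K i j (U j)) + (∑ j, Kb j i (U j)) + (2 * lam i) • U i))
    (hb : ∀ i, b i i ∈ V) :
    ∃ U : Fin N → H, (∀ i, U i ∈ V) ∧
      (∀ i, ∀ w ∈ V, JH K Kb lam Cc b c i (Function.update U i w) ≤ JH K Kb lam Cc b c i U) ∧
      ∀ U' : Fin N → H, (∀ i, U' i ∈ V) →
      (∀ i, ∀ w ∈ V, JH K Kb lam Cc b c i (Function.update U' i w) ≤ JH K Kb lam Cc b c i U') →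
      ∀ i, U i = U' i := by
  let M : Fin N → Fin N → H →L[ℝ] H := fun i j =>
    K i j + Kb j i + (if i = j then (2 * lam i) • ContinuousLinearMap.id ℝ H else 0)
  have hM : ∀ i j (v : H), M i j v =
      K i j v + Kb j i v + (if i = j then (2 * lam i) • v else 0) := by
    intro i j v
    by_cases h : i = j <;> simp [M, h]
  have hMs : ∀ (U : Fin N → H) i (w : H), ∑ j, inner ℝ w (M i j (U j)) =
      inner ℝ w ((∑ j, K i j (U j)) + (∑ j, Kb j i (U j)) + (2 * lam i) • U i) := by
    intro U i w
    simp [hM, Finset.sum_add_distrib, inner_add_right, inner_sum, inner_smul_right]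
    rw [← inner_sum, Finset.sum_ite_eq]
    simp [inner_smul_right]
  have hco' : ∀ U : Fin N → H, c₀ * ∑ i, inner ℝ (U i) (U i) ≤
      ∑ i, ∑ j, inner ℝ (U i) (M i j (U j)) := by
    intro U
    simp only [hMs]
    exact hco U
  have hdf : ∀ (U : Fin N → H) i (d : H),
      JH K Kb lam Cc b c i (Function.update U i (U i + d)) - JH K Kb lam Cc b c i U =
      - (∑ j, inner ℝ d (M i j (U j)) - inner ℝ (b i i) d)
      - (inner ℝ d (K i i d) + lam i * inner ℝ d d) := by
    intro U i d
    rw [JH_diff K Kb lam Cc b c hadj]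
    simp only [hM]
  have hQ : ∀ i (d : H), 0 ≤ inner ℝ d (K i i d) + lam i * inner ℝ d d := by
    intro i d
    have h := hco' (Pi.single i d)
    rw [Finset.sum_eq_single i (fun j _ hj => by simp [Pi.single_eq_of_ne hj]) (by simp),
      Finset.sum_eq_single i (fun j _ hj => by simp [Pi.single_eq_of_ne hj]) (by simp),
      Finset.sum_eq_single i (fun j _ hj => by simp [Pi.single_eq_of_ne hj]) (by simp)] at h
    simp only [Pi.single_eq_same, hM, if_true, inner_add_right, hadj, inner_smul_right] at h
    rw [real_inner_comm d (K i i d)] at h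
    have : 0 ≤ c₀ * inner ℝ d d := mul_nonneg hc₀.le real_inner_self_nonneg
    linarith
  have hfoc : ∀ U' : Fin N → H, (∀ i, U' i ∈ V) →
      (∀ i, ∀ w ∈ V, JH K Kb lam Cc b c i (Function.update U' i w) ≤ JH K Kb lam Cc b c i U') →
      ∀ i, ∀ w ∈ V, ∑ j, inner ℝ w (M i j (U' j)) = inner ℝ (b i i) w := by
    intro U' hU' hN i w hw
    rw [← sub_eq_zero]
    apply quad_zero (Q := inner ℝ w (K i i w) + lam i * inner ℝ w w)
    intro t
    have h1 := hN i (U' i + t • w) (V.add_mem (hU' i) (V.smul_mem t hw))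
    have h2 := hdf U' i (t • w)
    simp only [real_inner_smul_left, real_inner_smul_right, map_smul, ← Finset.mul_sum] at h2
    nlinarith [h1, h2]
  obtain ⟨U, hU⟩ := abs_exist V M c₀ hc₀ hco' (fun i => ⟨b i i, hb i⟩)
  refine ⟨fun i => U i, fun i => (U i).2, ?_, ?_⟩
  · intro i w hw
    have h2 := hdf (fun i => U i) i (w - U i)
    have h3 := hU i (⟨w, hw⟩ - U i)
    have h4 := hQ i (w - U i)
    simp only [add_sub_cancel] at h2
    simp only [Submodule.coe_sub] at h3
    rw [h3] at h2
    linarith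
  · intro U' hU' hN i
    have hf := hfoc U' hU' hN
    have h0 : ∑ i, ∑ j, inner ℝ ((U i : H) - U' i) (M i j ((U j : H) - U' j)) = 0 := by
      refine Finset.sum_eq_zero fun i _ => ?_
      have e1 := hU i (U i - ⟨U' i, hU' i⟩)
      have e2 := hf i (U i - U' i) (V.sub_mem (U i).2 (hU' i))
      simp only [Submodule.coe_sub] at e1
      simp only [map_sub, inner_sub_right _ (M i _ _), Finset.sum_sub_distrib]
      rw [e1, e2, sub_self]
    have h1 := hco' (fun i => (U i : H) - U' i)
    simp only [h0] at h1
    have h2 : ∑ i, inner ℝ ((U i : H) - U' i) ((U i : H) - U' i) = 0 := by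
      refine le_antisymm (by nlinarith) (Finset.sum_nonneg fun i _ => real_inner_self_nonneg)
    rw [Finset.sum_eq_zero_iff_of_nonneg (fun i _ => real_inner_self_nonneg)] at h2
    have := h2 i (Finset.mem_univ i)
    rw [inner_self_eq_zero, sub_eq_zero] at this
    exact this

abbrev muT (T : ℝ) : Measure ℝ := volume.restrict (Icc (0:ℝ) T)

abbrev nuT (T : ℝ) [MeasurableSpace Ω] (P : Measure Ω) : Measure (ℝ × Ω) := (muT T).prod P

def KF (T : ℝ) (G : ℝ → ℝ → ℝ) (v : ℝ × Ω → ℝ) : ℝ × Ω → ℝ :=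
  fun p => opK T G (fun s => v (s, p.2)) p.1

theorem KF_sm {T : ℝ} [MeasurableSpace Ω] {G : ℝ → ℝ → ℝ}
    (hG : Measurable (Function.uncurry G)) {v : ℝ × Ω → ℝ} (hv : Measurable v) :
    StronglyMeasurable (KF T G v) := by
  unfold KF opK
  refine StronglyMeasurable.integral_prod_right' (ν := volume.restrict (Icc (0:ℝ) T)) (f := fun q : (ℝ × Ω) × ℝ => G q.1.1 q.2 * v (q.2, q.1.2)) ?_
  apply Measurable.stronglyMeasurable
  have h1 : Measurable fun q : (ℝ × Ω) × ℝ => G q.1.1 q.2 :=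
    hG.comp (by fun_prop : Measurable fun q : (ℝ × Ω) × ℝ => (q.1.1, q.2))
  have h2 : Measurable fun q : (ℝ × Ω) × ℝ => v (q.2, q.1.2) :=
    hv.comp (by fun_prop)
  exact h1.mul h2

theorem KF_eLpNorm_le {T : ℝ} [MeasurableSpace Ω] {P : Measure Ω} [IsProbabilityMeasure P]
    {G : ℝ → ℝ → ℝ} (hG : Measurable (Function.uncurry G)) {v : ℝ × Ω → ℝ} (hv : Measurable v) :
    eLpNorm (KF T G v) 2 (nuT T P) ≤
      eLpNorm (fun p : ℝ × ℝ => G p.1 p.2) 2 ((muT T).prod (muT T)) * eLpNorm v 2 (nuT T P) := by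
  have hG1 : ∀ t, Measurable fun s => ‖G t s‖ₑ := fun t =>
    (hG.comp (by fun_prop : Measurable fun s : ℝ => (t, s))).enorm
  have hv1 : ∀ ω, Measurable fun s => ‖v (s, ω)‖ₑ := fun ω =>
    (hv.comp (by fun_prop : Measurable fun s : ℝ => (s, ω))).enorm
  have hpt : ∀ p : ℝ × Ω, ‖KF T G v p‖ₑ ^ (2:ℝ) ≤
      (∫⁻ s, ‖G p.1 s‖ₑ ^ (2:ℝ) ∂(muT T)) * ∫⁻ s, ‖v (s, p.2)‖ₑ ^ (2:ℝ) ∂(muT T) := by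
    intro p
    have h1 : ‖KF T G v p‖ₑ ≤ ∫⁻ s, ‖G p.1 s‖ₑ * ‖v (s, p.2)‖ₑ ∂(muT T) := by
      refine (enorm_integral_le_lintegral_enorm _).trans (le_of_eq ?_)
      simp only [enorm_mul]
    have h2 := ENNReal.lintegral_mul_le_Lp_mul_Lq (muT T) Real.HolderConjugate.two_two
      (hG1 p.1).aemeasurable (hv1 p.2).aemeasurable
    have h3 := ENNReal.rpow_le_rpow (h1.trans h2) (by norm_num : (0:ℝ) ≤ 2)
    refine h3.trans (le_of_eq ?_)
    rw [ENNReal.mul_rpow_of_nonneg _ _ (by norm_num), ← ENNReal.rpow_mul, ← ENNReal.rpow_mul]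
    norm_num
  have hGm : Measurable fun p : ℝ × ℝ => ‖G p.1 p.2‖ₑ ^ (2:ℝ) := (hG.enorm).pow_const _
  have hvm : Measurable fun p : ℝ × Ω => ‖v p‖ₑ ^ (2:ℝ) := (hv.enorm).pow_const _
  have hI : ∫⁻ p, ‖KF T G v p‖ₑ ^ (2:ℝ) ∂(nuT T P) ≤
      (∫⁻ p : ℝ × ℝ, ‖G p.1 p.2‖ₑ ^ (2:ℝ) ∂((muT T).prod (muT T))) *
        ∫⁻ p, ‖v p‖ₑ ^ (2:ℝ) ∂(nuT T P) := by
    refine (lintegral_mono hpt).trans (le_of_eq ?_)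
    rw [lintegral_prod_mul (f := fun t => ∫⁻ s, ‖G t s‖ₑ ^ (2:ℝ) ∂(muT T))
      (g := fun ω => ∫⁻ s, ‖v (s, ω)‖ₑ ^ (2:ℝ) ∂(muT T))]
    · rw [lintegral_prod _ hGm.aemeasurable, lintegral_prod_symm _ hvm.aemeasurable]
    · exact hGm.lintegral_prod_right'.aemeasurable
    · exact (hvm.lintegral_prod_left').aemeasurable
  rw [eLpNorm_eq_lintegral_rpow_enorm_toReal (by norm_num) (by norm_num),
    eLpNorm_eq_lintegral_rpow_enorm_toReal (by norm_num) (by norm_num),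
    eLpNorm_eq_lintegral_rpow_enorm_toReal (by norm_num) (by norm_num)]
  rw [← ENNReal.mul_rpow_of_nonneg _ _ (by positivity)]
  exact ENNReal.rpow_le_rpow hI (by positivity)

theorem kernel_memLp {T : ℝ} {G : ℝ → ℝ → ℝ} (hG : IsL2Kernel T G) :
    MemLp (fun p : ℝ × ℝ => G p.1 p.2) 2 ((muT T).prod (muT T)) :=
  (memLp_two_iff_integrable_sq hG.1.aestronglyMeasurable).2 hG.2

theorem kernel_adj {T : ℝ} {G : ℝ → ℝ → ℝ} (hG : IsL2Kernel T G) :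
    IsL2Kernel T (fun t s => G s t) :=
  ⟨hG.1.comp measurable_swap, hG.2.swap⟩

theorem KF_memLp {T : ℝ} [MeasurableSpace Ω] {P : Measure Ω} [IsProbabilityMeasure P]
    {G : ℝ → ℝ → ℝ} (hG : IsL2Kernel T G) {v : ℝ × Ω → ℝ} (hv : Measurable v)
    (hv2 : MemLp v 2 (nuT T P)) : MemLp (KF T G v) 2 (nuT T P) :=
  ⟨(KF_sm hG.1 hv).aestronglyMeasurable, (KF_eLpNorm_le hG.1 hv).trans_lt
    (ENNReal.mul_lt_top (kernel_memLp hG).2 hv2.2)⟩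

/-- a.e. sections -/
theorem ae_sections {T : ℝ} [MeasurableSpace Ω] {P : Measure Ω} [IsProbabilityMeasure P]
    {p : ℝ × Ω → Prop} (h : ∀ᵐ x ∂(nuT T P), p x) :
    ∀ᵐ ω ∂P, ∀ᵐ t ∂(muT T), p (t, ω) := by
  have h' : ∀ᵐ x ∂(P.prod (muT T)), p x.swap :=
    (Measure.measurePreserving_swap (μ := P) (ν := muT T)).quasiMeasurePreserving.ae h
  exact Measure.ae_ae_of_ae_prod h'

theorem ae_of_ae_snd {T : ℝ} [MeasurableSpace Ω] {P : Measure Ω} [IsProbabilityMeasure P]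
    {p : Ω → Prop} (h : ∀ᵐ ω ∂P, p ω) : ∀ᵐ x ∂(nuT T P), p x.2 :=
  Measure.quasiMeasurePreserving_snd.ae h

theorem ae_of_ae_fst {T : ℝ} [MeasurableSpace Ω] {P : Measure Ω} [IsProbabilityMeasure P]
    {p : ℝ → Prop} (h : ∀ᵐ t ∂(muT T), p t) : ∀ᵐ x ∂(nuT T P), p x.1 :=
  Measure.quasiMeasurePreserving_fst.ae h

theorem KF_congr {T : ℝ} [MeasurableSpace Ω] {P : Measure Ω} [IsProbabilityMeasure P]
    (G : ℝ → ℝ → ℝ) {v v' : ℝ × Ω → ℝ} (h : v =ᵐ[nuT T P] v') :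
    KF T G v =ᵐ[nuT T P] KF T G v' := by
  filter_upwards [ae_of_ae_snd (T := T) (ae_sections h)] with x hx
  unfold KF opK
  refine integral_congr_ae ?_
  filter_upwards [hx] with s hs
  rw [hs]

theorem section_memLp {T : ℝ} [MeasurableSpace Ω] {P : Measure Ω} [IsProbabilityMeasure P]
    {v : ℝ × Ω → ℝ} (hv : Measurable v) (hv2 : MemLp v 2 (nuT T P)) :
    ∀ᵐ ω ∂P, MemLp (fun t => v (t, ω)) 2 (muT T) := by
  have h := (memLp_two_iff_integrable_sq hv.aestronglyMeasurable).1 hv2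
  filter_upwards [h.prod_left_ae] with ω hω
  exact (memLp_two_iff_integrable_sq
    (hv.comp (by fun_prop : Measurable fun s : ℝ => (s, ω))).aestronglyMeasurable).2 hω

theorem kernel_section {T : ℝ} {G : ℝ → ℝ → ℝ} (hG : IsL2Kernel T G) :
    ∀ᵐ t ∂(muT T), MemLp (fun s => G t s) 2 (muT T) := by
  filter_upwards [hG.2.prod_right_ae] with t ht
  exact (memLp_two_iff_integrable_sq
    (hG.1.comp (by fun_prop : Measurable fun s : ℝ => (t, s))).aestronglyMeasurable).2 ht

theorem KF_add {T : ℝ} [MeasurableSpace Ω] {P : Measure Ω} [IsProbabilityMeasure P]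
    {G : ℝ → ℝ → ℝ} (hG : IsL2Kernel T G) {v w : ℝ × Ω → ℝ} (hv : Measurable v)
    (hv2 : MemLp v 2 (nuT T P)) (hw : Measurable w) (hw2 : MemLp w 2 (nuT T P)) :
    KF T G (v + w) =ᵐ[nuT T P] KF T G v + KF T G w := by
  filter_upwards [ae_of_ae_snd (T := T) (section_memLp hv hv2),
    ae_of_ae_snd (T := T) (section_memLp hw hw2),
    ae_of_ae_fst (P := P) (kernel_section hG)] with x h1 h2 h3
  simp only [KF, opK, Pi.add_apply, mul_add]
  exact integral_add (h3.integrable_mul h1) (h3.integrable_mul h2)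

theorem KF_smul {T : ℝ} (G : ℝ → ℝ → ℝ) (c : ℝ) (v : ℝ × Ω → ℝ) :
    KF T G (c • v) = c • KF T G v := by
  funext x
  simp only [KF, opK, Pi.smul_apply, smul_eq_mul, mul_left_comm _ c]
  exact integral_const_mul _ _

/-- the operator on `L²(dt ⊗ dP)`. -/
def KL {T : ℝ} [MeasurableSpace Ω] {P : Measure Ω} [IsProbabilityMeasure P]
    {G : ℝ → ℝ → ℝ} (hG : IsL2Kernel T G) : Lp ℝ 2 (nuT T P) →L[ℝ] Lp ℝ 2 (nuT T P) :=
  LinearMap.mkContinuous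
    { toFun := fun v => (KF_memLp hG (Lp.stronglyMeasurable v).measurable (Lp.memLp v)).toLp _
      map_add' := by
        intro v w
        rw [← MemLp.toLp_add]
        refine MemLp.toLp_congr _ _ ?_
        exact (KF_congr G (Lp.coeFn_add v w)).trans (KF_add hG
          (Lp.stronglyMeasurable v).measurable (Lp.memLp v)
          (Lp.stronglyMeasurable w).measurable (Lp.memLp w))
      map_smul' := by
        intro c v
        simp only [RingHom.id_apply]
        rw [← MemLp.toLp_const_smul]
        refine MemLp.toLp_congr _ _ ?_
        rw [← KF_smul]
        exact KF_congr G (Lp.coeFn_smul c v) }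
    (eLpNorm (fun p : ℝ × ℝ => G p.1 p.2) 2 ((muT T).prod (muT T))).toReal
    (by
      intro v
      simp only [LinearMap.coe_mk, AddHom.coe_mk, Lp.norm_toLp]
      rw [Lp.norm_def, ← ENNReal.toReal_mul]
      exact ENNReal.toReal_mono (ENNReal.mul_ne_top (kernel_memLp hG).2.ne (Lp.memLp v).2.ne)
        (KF_eLpNorm_le hG.1 (Lp.stronglyMeasurable v).measurable))

theorem KL_toLp {T : ℝ} [MeasurableSpace Ω] {P : Measure Ω} [IsProbabilityMeasure P]
    {G : ℝ → ℝ → ℝ} (hG : IsL2Kernel T G) {v : ℝ × Ω → ℝ} (hv : Measurable v)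
    (hv2 : MemLp v 2 (nuT T P)) :
    KL hG (hv2.toLp v) = (KF_memLp hG hv hv2).toLp _ := by
  change (KF_memLp hG (Lp.stronglyMeasurable (hv2.toLp v)).measurable
    (Lp.memLp (hv2.toLp v))).toLp _ = _
  exact MemLp.toLp_congr _ _ (KF_congr G hv2.coeFn_toLp)

theorem inner_toLp_toLp {α : Type*} [MeasurableSpace α] {μ : Measure α} {f g : α → ℝ}
    (hf : MemLp f 2 μ) (hg : MemLp g 2 μ) :
    inner ℝ (hf.toLp f) (hg.toLp g) = ∫ x, f x * g x ∂μ := by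
  rw [L2.inner_def]
  refine integral_congr_ae ?_
  filter_upwards [hf.coeFn_toLp, hg.coeFn_toLp] with x h1 h2
  rw [h1, h2]
  simp [mul_comm]

theorem inner_toLp_ip {T : ℝ} [MeasurableSpace Ω] {P : Measure Ω} [IsProbabilityMeasure P]
    {f g : ℝ × Ω → ℝ} (hf : MemLp f 2 (nuT T P)) (hg : MemLp g 2 (nuT T P)) :
    inner ℝ (hf.toLp f) (hg.toLp g) =
      ∫ ω, ip T (fun t => f (t, ω)) (fun t => g (t, ω)) ∂P := by
  rw [inner_toLp_toLp]
  exact integral_prod_symm _ (hf.integrable_mul hg)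

theorem ip_integrable {T : ℝ} [MeasurableSpace Ω] {P : Measure Ω} [IsProbabilityMeasure P]
    {f g : ℝ × Ω → ℝ} (hf : MemLp f 2 (nuT T P)) (hg : MemLp g 2 (nuT T P)) :
    Integrable (fun ω => ip T (fun t => f (t, ω)) (fun t => g (t, ω))) P :=
  (hf.integrable_mul hg).integral_prod_right

theorem KL_adj {T : ℝ} [MeasurableSpace Ω] {P : Measure Ω} [IsProbabilityMeasure P]
    {G : ℝ → ℝ → ℝ} (hG : IsL2Kernel T G) (u v : Lp ℝ 2 (nuT T P)) :
    inner ℝ u (KL (kernel_adj hG) v) = inner ℝ (KL hG u) v := by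
  have hu := (Lp.stronglyMeasurable u).measurable
  have hv := (Lp.stronglyMeasurable v).measurable
  have hu2 := Lp.memLp u
  have hv2 := Lp.memLp v
  have h1 := KL_toLp (kernel_adj hG) hv hv2
  have h2 := KL_toLp hG hu hu2
  rw [Lp.toLp_coeFn] at h1 h2
  rw [h1, h2]
  conv_lhs => rw [← Lp.toLp_coeFn u hu2]
  conv_rhs => rw [← Lp.toLp_coeFn v hv2]
  rw [inner_toLp_ip, inner_toLp_ip]
  refine integral_congr_ae ?_
  filter_upwards [section_memLp hu hu2, section_memLp hv hv2] with ω h3 h4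
  simp only [ip, KF, opK, ← integral_const_mul, ← integral_mul_const]
  rw [integral_integral_swap]
  · refine integral_congr_ae (Eventually.of_forall fun s => ?_)
    refine integral_congr_ae (Eventually.of_forall fun t => ?_)
    simp only
    ring
  · have h5 : MemLp (fun p : ℝ × ℝ => u (p.1, ω) * v (p.2, ω)) 2 ((muT T).prod (muT T)) := by
      refine (memLp_two_iff_integrable_sq ?_).2 ?_
      · exact ((hu.comp (by fun_prop : Measurable fun s : ℝ × ℝ => (s.1, ω))).mul
          (hv.comp (by fun_prop : Measurable fun s : ℝ × ℝ => (s.2, ω)))).aestronglyMeasurable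
      · simp only [mul_pow]
        exact Integrable.mul_prod ((memLp_two_iff_integrable_sq h3.1).1 h3)
          ((memLp_two_iff_integrable_sq h4.1).1 h4)
    refine (h5.integrable_mul (kernel_memLp (kernel_adj hG))).congr
      (Eventually.of_forall fun p => ?_)
    simp only [Function.uncurry, Pi.mul_apply]
    ring

theorem isProg_def {mΩ : MeasurableSpace Ω} (F : Filtration ℝ mΩ) (α : ℝ → Ω → ℝ) :
    ProgMeasurable F α ↔ ∀ t : ℝ,
      StronglyMeasurable[MeasurableSpace.prod inferInstance (F t)]
        fun p : Iic t × Ω => α p.1 p.2 := Iff.rfl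

/-- progressive sigma-algebra -/
def progM {mΩ : MeasurableSpace Ω} (F : Filtration ℝ mΩ) : MeasurableSpace (ℝ × Ω) :=
  ⨅ t : ℝ, MeasurableSpace.map (fun p : Iic t × Ω => ((p.1 : ℝ), p.2))
    (MeasurableSpace.prod inferInstance (F t))

theorem progM_set {mΩ : MeasurableSpace Ω} (F : Filtration ℝ mΩ) (A : Set (ℝ × Ω)) :
    MeasurableSet[progM F] A ↔ ∀ t : ℝ, MeasurableSet[MeasurableSpace.prod inferInstance (F t)]
      ((fun p : Iic t × Ω => ((p.1 : ℝ), p.2)) ⁻¹' A) := by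
  unfold progM
  rw [MeasurableSpace.measurableSet_iInf]
  rfl

theorem progM_le {mΩ : MeasurableSpace Ω} (F : Filtration ℝ mΩ) :
    progM F ≤ (inferInstance : MeasurableSpace (ℝ × Ω)) := by
  intro A hA
  rw [progM_set] at hA
  have hU : A = ⋃ n : ℕ, (fun p : Iic (n : ℝ) × Ω => ((p.1 : ℝ), p.2)) ''
      ((fun p : Iic (n : ℝ) × Ω => ((p.1 : ℝ), p.2)) ⁻¹' A) := by
    ext ⟨t, ω⟩
    simp only [mem_iUnion, mem_image, mem_preimage, Prod.exists, Prod.mk.injEq]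
    constructor
    · intro h
      obtain ⟨n, hn⟩ := exists_nat_ge t
      exact ⟨n, ⟨t, hn⟩, ω, h, rfl, rfl⟩
    · rintro ⟨n, s, w, h, h1, h2⟩
      rw [← h1, ← h2]; exact h
  rw [hU]
  refine MeasurableSet.iUnion fun n => ?_
  have hemb : MeasurableEmbedding (fun p : Iic (n : ℝ) × Ω => ((p.1 : ℝ), p.2)) :=
    (MeasurableEmbedding.subtype_coe measurableSet_Iic).prodMap MeasurableEmbedding.id
  refine hemb.measurableSet_image.2 ?_
  have hle : MeasurableSpace.prod (inferInstance : MeasurableSpace (Iic (n:ℝ))) (F n) ≤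
      MeasurableSpace.prod inferInstance mΩ :=
    sup_le_sup le_rfl (MeasurableSpace.comap_mono (F.le n))
  exact hle _ (hA n)

theorem prog_iff {mΩ : MeasurableSpace Ω} (F : Filtration ℝ mΩ) (α : ℝ → Ω → ℝ) :
    ProgMeasurable F α ↔ Measurable[progM F] (fun p : ℝ × Ω => α p.1 p.2) := by
  rw [isProg_def]
  constructor
  · intro h A hA
    rw [progM_set]
    intro t
    exact (h t).measurable hA
  · intro h t
    refine @Measurable.stronglyMeasurable _ _ (_) _ _ _ _ _ _ ?_
    intro A hA
    exact (progM_set F _).1 (h hA) t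

theorem adm_meas {mΩ : MeasurableSpace Ω} {F : Filtration ℝ mΩ} {α : ℝ → Ω → ℝ}
    (h : ProgMeasurable F α) : Measurable (fun p : ℝ × Ω => α p.1 p.2) :=
  ((prog_iff F α).1 h).mono (progM_le F) le_rfl

theorem adm_memLp {mΩ : MeasurableSpace Ω} {F : Filtration ℝ mΩ} {P : Measure Ω} {T : ℝ}
    {α : ℝ → Ω → ℝ} (h : ProgMeasurable F α) (h2 : SqInt T P α) :
    MemLp (fun p : ℝ × Ω => α p.1 p.2) 2 (nuT T P) :=
  (memLp_two_iff_integrable_sq (adm_meas h).aestronglyMeasurable).2 h2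

open Classical in
/-- class of a process in `L²`. -/
def cls (T : ℝ) {mΩ : MeasurableSpace Ω} (P : Measure Ω) (α : ℝ → Ω → ℝ) : Lp ℝ 2 (nuT T P) :=
  if h : MemLp (fun p : ℝ × Ω => α p.1 p.2) 2 (nuT T P) then h.toLp _ else 0

theorem cls_eq {T : ℝ} {mΩ : MeasurableSpace Ω} {P : Measure Ω} {α : ℝ → Ω → ℝ}
    (h : MemLp (fun p : ℝ × Ω => α p.1 p.2) 2 (nuT T P)) : cls T P α = h.toLp _ := dif_pos h

theorem cls_mem {mΩ : MeasurableSpace Ω} {F : Filtration ℝ mΩ} {P : Measure Ω} {T : ℝ}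
    {α : ℝ → Ω → ℝ} (h : ProgMeasurable F α) (h2 : SqInt T P α) :
    cls T P α ∈ lpMeas ℝ ℝ (progM F) 2 (nuT T P) := by
  rw [cls_eq (adm_memLp h h2), mem_lpMeas_iff_aestronglyMeasurable]
  exact ⟨fun p => α p.1 p.2, @Measurable.stronglyMeasurable _ _ (_) _ _ _ _ _ _
    ((prog_iff F α).1 h), MemLp.coeFn_toLp _⟩

theorem exists_rep {mΩ : MeasurableSpace Ω} {F : Filtration ℝ mΩ} {P : Measure Ω} {T : ℝ}
    (U : Lp ℝ 2 (nuT T P)) (hU : U ∈ lpMeas ℝ ℝ (progM F) 2 (nuT T P)) :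
    ∃ α : ℝ → Ω → ℝ, Admissible T F P α ∧ cls T P α = U := by
  rw [mem_lpMeas_iff_aestronglyMeasurable] at hU
  obtain ⟨g, hg, hgU⟩ := hU
  have hp : ProgMeasurable F (fun t ω => g (t, ω)) := by
    rw [prog_iff]
    exact StronglyMeasurable.measurable hg
  have hm : MemLp (fun p : ℝ × Ω => g (p.1, p.2)) 2 (nuT T P) :=
    (memLp_congr_ae hgU).1 (Lp.memLp U)
  refine ⟨fun t ω => g (t, ω), ⟨hp, ?_⟩, ?_⟩
  · exact (memLp_two_iff_integrable_sq (adm_meas hp).aestronglyMeasurable).1 hm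
  · rw [cls_eq hm]
    apply Lp.ext
    exact hm.coeFn_toLp.trans hgU.symm

theorem int_split {mΩ : MeasurableSpace Ω} {P : Measure Ω} {ι : Type*} (s : Finset ι)
    {f1 f4 c : Ω → ℝ} {f2 f5 : ι → Ω → ℝ} {f3 : ι → ι → Ω → ℝ}
    (i1 : Integrable f1 P) (i2 : ∀ j, Integrable (f2 j) P) (i3 : ∀ j k, Integrable (f3 j k) P)
    (i4 : Integrable f4 P) (i5 : ∀ j, Integrable (f5 j) P) (ic : Integrable c P) :
    ∫ ω, (-f1 ω - ∑ j ∈ s, f2 j ω - ∑ j ∈ s, ∑ k ∈ s, f3 j k ω + f4 ω + ∑ j ∈ s, f5 j ω + c ω) ∂P =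
    -∫ ω, f1 ω ∂P - ∑ j ∈ s, ∫ ω, f2 j ω ∂P - ∑ j ∈ s, ∑ k ∈ s, ∫ ω, f3 j k ω ∂P + ∫ ω, f4 ω ∂P
      + ∑ j ∈ s, ∫ ω, f5 j ω ∂P + ∫ ω, c ω ∂P := by
  have s2 := integrable_finsetSum s fun j _ => i2 j
  have s3' := fun j => integrable_finsetSum s fun k _ => i3 j k
  have s3 := integrable_finsetSum s fun j _ => s3' j
  have s5 := integrable_finsetSum s fun j _ => i5 j
  have a1 : Integrable (fun ω => -f1 ω) P := i1.neg
  have a2 : Integrable (fun ω => -f1 ω - ∑ j ∈ s, f2 j ω) P := a1.sub s2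
  have a3 : Integrable (fun ω => -f1 ω - ∑ j ∈ s, f2 j ω - ∑ j ∈ s, ∑ k ∈ s, f3 j k ω) P :=
    a2.sub s3
  have a4 : Integrable (fun ω => -f1 ω - ∑ j ∈ s, f2 j ω - ∑ j ∈ s, ∑ k ∈ s, f3 j k ω
    + f4 ω) P := a3.add i4
  have a5 : Integrable (fun ω => -f1 ω - ∑ j ∈ s, f2 j ω - ∑ j ∈ s, ∑ k ∈ s, f3 j k ω
    + f4 ω + ∑ j ∈ s, f5 j ω) P := a4.add s5
  rw [integral_add a5 ic, integral_add a4 s5, integral_add a3 i4, integral_sub a2 s3,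
    integral_sub a1 s2, integral_neg,
    integral_finsetSum _ fun j _ => i2 j, integral_finsetSum _ fun j _ => i5 j,
    integral_finsetSum _ fun j _ => s3' j]
  simp only [integral_finsetSum _ fun k _ => i3 _ k]

theorem Jfin_eq {mΩ : MeasurableSpace Ω} (P : Measure Ω) [IsProbabilityMeasure P]
    (T : ℝ) {N : ℕ}
    (B Bbar : Fin N → Fin N → ℝ → ℝ → ℝ) (lam : Fin N → ℝ)
    (C : Fin N → Fin N → Fin N → ℝ → ℝ → ℝ)
    (b : Fin N → Fin N → ℝ → Ω → ℝ) (c : Fin N → Ω → ℝ)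
    (hB : ∀ i j, IsL2Kernel T (B i j)) (hBbar : ∀ i j, IsL2Kernel T (Bbar i j))
    (hC : ∀ i j k, IsL2Kernel T (C i j k))
    (hb : ∀ i j, MemLp (fun p : ℝ × Ω => b i j p.1 p.2) 2 (nuT T P))
    (hc : ∀ i, Integrable (c i) P) (i : Fin N) (α : Fin N → ℝ → Ω → ℝ)
    (hα : ∀ i, Measurable (fun p : ℝ × Ω => α i p.1 p.2))
    (hα2 : ∀ i, MemLp (fun p : ℝ × Ω => α i p.1 p.2) 2 (nuT T P)) :
    Jfin T P B Bbar lam C b c i α =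
      JH (fun i j => KL (hB i j)) (fun i j => KL (kernel_adj (hBbar i j))) lam
        (fun i j k => KL (hC i j k)) (fun i j => cls T P (b i j)) (fun i => ∫ ω, c i ω ∂P) i
        (fun j => cls T P (α j)) := by
  have m1 : ∀ j, MemLp (KF T (B i j) (fun p : ℝ × Ω => α j p.1 p.2)) 2 (nuT T P) :=
    fun j => KF_memLp (hB i j) (hα j) (hα2 j)
  have m2 : ∀ j, MemLp (KF T (fun t s => Bbar j i s t) (fun p : ℝ × Ω => α j p.1 p.2)) 2
      (nuT T P) := fun j => KF_memLp (kernel_adj (hBbar j i)) (hα j) (hα2 j)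
  have m3 : ∀ j k, MemLp (KF T (C i j k) (fun p : ℝ × Ω => α k p.1 p.2)) 2 (nuT T P) :=
    fun j k => KF_memLp (hC i j k) (hα k) (hα2 k)
  have m4 := (m1 i).add ((hα2 i).const_smul (lam i))
  have m5 := fun j => (m1 j).add (m2 j)
  have e1 := inner_toLp_ip (hα2 i) m4
  have e2 := fun j => inner_toLp_ip (hα2 i) (m5 j)
  have e3 := fun j k => inner_toLp_ip (hα2 j) (m3 j k)
  have e4 := fun j => inner_toLp_ip (hb i j) (hα2 j)
  rw [MemLp.toLp_add (m1 i) ((hα2 i).const_smul (lam i)),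
    MemLp.toLp_const_smul (lam i) (hα2 i)] at e1
  have e2' : ∀ j, _ := fun j => (congrArg (inner ℝ ((hα2 i).toLp _))
    (MemLp.toLp_add (m1 j) (m2 j))).symm.trans (e2 j)
  refine (int_split (Finset.univ.erase i) (ip_integrable (hα2 i) m4)
    (fun j => ip_integrable (hα2 i) (m5 j)) (fun j k => ip_integrable (hα2 j) (m3 j k))
    (ip_integrable (hb i i) (hα2 i)) (fun j => ip_integrable (hb i j) (hα2 j)) (hc i)).trans ?_
  unfold JH
  simp only [cls_eq (hα2 _), cls_eq (hb _ _), KL_toLp _ (hα _) (hα2 _)]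
  rw [← e1]
  simp only [← e2', ← e3, ← e4]

theorem coerc_lift {mΩ : MeasurableSpace Ω} (P : Measure Ω) [IsProbabilityMeasure P]
    (T : ℝ) {N : ℕ}
    (B Bbar : Fin N → Fin N → ℝ → ℝ → ℝ) (lam : Fin N → ℝ)
    (hB : ∀ i j, IsL2Kernel T (B i j)) (hBbar : ∀ i j, IsL2Kernel T (Bbar i j))
    (c₀ : ℝ)
    (hcoerc : ∀ f : ℝ → Fin N → ℝ, MemL2N T f →
      c₀ * (∫ t in Icc (0:ℝ) T, ∑ i, (f t i) ^ 2) ≤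
        ∫ t in Icc (0:ℝ) T, ∑ i, f t i *
          ((∑ j, opK T (B i j) (fun s => f s j) t)
            + (∑ j, opKadj T (Bbar j i) (fun s => f s j) t) + 2 * lam i * f t i))
    (U : Fin N → Lp ℝ 2 (nuT T P)) :
    c₀ * ∑ i, inner ℝ (U i) (U i) ≤
      ∑ i, inner ℝ (U i) ((∑ j, KL (hB i j) (U j)) + (∑ j, KL (kernel_adj (hBbar j i)) (U j))
        + (2 * lam i) • U i) := by
  have hu : ∀ i, Measurable (U i) := fun i => (Lp.stronglyMeasurable (U i)).measurable
  have hu2 : ∀ i, MemLp (U i) 2 (nuT T P) := fun i => Lp.memLp (U i)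
  let W : Fin N → ℝ × Ω → ℝ := fun i p =>
    (∑ j, KF T (B i j) (U j) p) + (∑ j, KF T (fun t s => Bbar j i s t) (U j) p)
      + 2 * lam i * U i p
  let X : Fin N → Lp ℝ 2 (nuT T P) := fun i =>
    (∑ j, KL (hB i j) (U j)) + (∑ j, KL (kernel_adj (hBbar j i)) (U j)) + (2 * lam i) • U i
  have hK : ∀ {G : ℝ → ℝ → ℝ} (hG : IsL2Kernel T G) j, KL hG (U j) =ᵐ[nuT T P] KF T G (U j) := by
    intro G hG j
    have h := KL_toLp hG (hu j) (hu2 j)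
    rw [Lp.toLp_coeFn] at h
    rw [h]
    exact MemLp.coeFn_toLp _
  have hXW : ∀ i, X i =ᵐ[nuT T P] W i := by
    intro i
    have h1 : ∀ᵐ p ∂(nuT T P), ∀ j, KL (hB i j) (U j) p = KF T (B i j) (U j) p :=
      ae_all_iff.2 fun j => hK (hB i j) j
    have h2 : ∀ᵐ p ∂(nuT T P), ∀ j, KL (kernel_adj (hBbar j i)) (U j) p =
        KF T (fun t s => Bbar j i s t) (U j) p :=
      ae_all_iff.2 fun j => hK (kernel_adj (hBbar j i)) j
    filter_upwards [h1, h2,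
      Lp.coeFn_add ((∑ j, KL (hB i j) (U j)) + (∑ j, KL (kernel_adj (hBbar j i)) (U j)))
        ((2 * lam i) • U i),
      Lp.coeFn_add (∑ j, KL (hB i j) (U j)) (∑ j, KL (kernel_adj (hBbar j i)) (U j)),
      Lp.coeFn_smul (2 * lam i) (U i),
      Lp.coeFn_finsetSum Finset.univ (fun j => KL (hB i j) (U j)),
      Lp.coeFn_finsetSum Finset.univ (fun j => KL (kernel_adj (hBbar j i)) (U j))]
      with p a1 a2 a3 a4 a5 a6 a7
    simp only [X, W]
    rw [a3, Pi.add_apply, a4, Pi.add_apply, a5, a6, a7]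
    simp only [Finset.sum_apply, a1, a2, Pi.smul_apply, smul_eq_mul]
  have hW2 : ∀ i, MemLp (W i) 2 (nuT T P) := fun i => (memLp_congr_ae (hXW i)).1 (Lp.memLp (X i))
  have hin : ∀ i, inner ℝ (U i) (X i) = ∫ p, U i p * W i p ∂(nuT T P) := by
    intro i
    rw [L2.inner_def]
    refine integral_congr_ae ?_
    filter_upwards [hXW i] with p hp
    rw [hp]
    simp [mul_comm]
  have hin0 : ∀ i, inner ℝ (U i) (U i) = ∫ p, U i p ^ 2 ∂(nuT T P) := by
    intro i
    rw [L2.inner_def]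
    refine integral_congr_ae (Eventually.of_forall fun p => ?_)
    simp [sq]
  have g1 : ∀ i, Integrable (fun p => U i p * W i p) (nuT T P) :=
    fun i => (hu2 i).integrable_mul (hW2 i)
  have g0 : ∀ i, Integrable (fun p => U i p ^ 2) (nuT T P) :=
    fun i => (memLp_two_iff_integrable_sq (hu2 i).1).1 (hu2 i)
  have G1 := integrable_finsetSum Finset.univ fun i _ => g1 i
  have G0 := integrable_finsetSum Finset.univ fun i _ => g0 i
  change c₀ * ∑ i, inner ℝ (U i) (U i) ≤ ∑ i, inner ℝ (U i) (X i)
  simp only [hin, hin0]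
  rw [← integral_finsetSum _ fun i _ => g1 i, ← integral_finsetSum _ fun i _ => g0 i,
    integral_prod_symm _ G1, integral_prod_symm _ G0, ← integral_const_mul]
  refine integral_mono_ae (G0.integral_prod_right.const_mul c₀) G1.integral_prod_right ?_
  filter_upwards [G0.prod_left_ae] with ω hω
  exact hcoerc (fun t i => U i (t, ω))
    ⟨fun i => (hu i).comp (by fun_prop : Measurable fun s : ℝ => (s, ω)), hω⟩

/-- Under Assumptions (A) and (C), the `N`-player game admits a Nash
equilibrium, unique up to `dℙ⊗dt`-a.e. equality of every component. -/
theorem finite_player_nash_exists_unique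
    {Ω : Type} {mΩ : MeasurableSpace Ω} (P : Measure Ω) [IsProbabilityMeasure P]
    (F : Filtration ℝ mΩ) (T : ℝ) (hT : 0 < T) (N : ℕ)
    (B Bbar : Fin N → Fin N → ℝ → ℝ → ℝ) (lam : Fin N → ℝ)
    (C : Fin N → Fin N → Fin N → ℝ → ℝ → ℝ)
    (b : Fin N → Fin N → ℝ → Ω → ℝ) (c : Fin N → Ω → ℝ)
    -- Assumption (A)
    (hB : ∀ i j, IsVolterraKernel T (B i j))
    (hBbar : ∀ i j, IsVolterraKernel T (Bbar i j))
    (hdiag : ∀ i, Bbar i i = B i i)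
    (hlam : ∀ i, 0 < lam i)
    (hC : ∀ i j k, IsVolterraKernel T (C i j k))
    (hb : ∀ i j, ProgMeasurable F (b i j) ∧ SqInt T P (b i j))
    (hc : ∀ i, Integrable (c i) P ∧ Measurable[F T] (c i))
    -- Assumption (C): coercivity of `𝐁 + 𝐁̄* + 2Λ` on `L²([0,T],ℝ^N)`
    (c₀ : ℝ) (hc₀ : 0 < c₀)
    (hcoerc : ∀ f : ℝ → Fin N → ℝ, MemL2N T f →
      c₀ * (∫ t in Icc (0:ℝ) T, ∑ i, (f t i) ^ 2) ≤
        ∫ t in Icc (0:ℝ) T, ∑ i, f t i *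
          ((∑ j, opK T (B i j) (fun s => f s j) t)
            + (∑ j, opKadj T (Bbar j i) (fun s => f s j) t) + 2 * lam i * f t i))
 :
    ∃ αhat : Fin N → ℝ → Ω → ℝ,
      IsNashFin T F P B Bbar lam C b c αhat ∧
        ∀ βhat : Fin N → ℝ → Ω → ℝ, IsNashFin T F P B Bbar lam C b c βhat →
          ∀ i, ∀ᵐ p ∂((volume.restrict (Icc (0:ℝ) T)).prod P),
            αhat i p.1 p.2 = βhat i p.1 p.2 := by
  have hB' : ∀ i j, IsL2Kernel T (B i j) := fun i j => (hB i j).1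
  have hBbar' : ∀ i j, IsL2Kernel T (Bbar i j) := fun i j => (hBbar i j).1
  have hC' : ∀ i j k, IsL2Kernel T (C i j k) := fun i j k => (hC i j k).1
  have hb2 : ∀ i j, MemLp (fun p : ℝ × Ω => b i j p.1 p.2) 2 (nuT T P) :=
    fun i j => adm_memLp (hb i j).1 (hb i j).2
  haveI : Fact (progM F ≤ (inferInstance : MeasurableSpace (ℝ × Ω))) := ⟨progM_le F⟩
  have hJ : ∀ i (α : Fin N → ℝ → Ω → ℝ), (∀ i, Admissible T F P (α i)) →
      Jfin T P B Bbar lam C b c i α =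
      JH (fun i j => KL (hB' i j)) (fun i j => KL (kernel_adj (hBbar' i j))) lam
        (fun i j k => KL (hC' i j k)) (fun i j => cls T P (b i j)) (fun i => ∫ ω, c i ω ∂P) i
        (fun j => cls T P (α j)) := fun i α hα =>
    Jfin_eq P T B Bbar lam C b c hB' hBbar' hC' hb2 (fun i => (hc i).1) i α
      (fun i => adm_meas (hα i).1) (fun i => adm_memLp (hα i).1 (hα i).2)
  have hupd : ∀ i (α : Fin N → ℝ → Ω → ℝ) (β : ℝ → Ω → ℝ),
      (fun j => cls T P (Function.update α i β j)) =
        Function.update (fun j => cls T P (α j)) i (cls T P β) := by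
    intro i α β
    funext j
    by_cases h : j = i
    · subst h; simp
    · simp [h]
  have hupa : ∀ i (α : Fin N → ℝ → Ω → ℝ) (β : ℝ → Ω → ℝ), (∀ i, Admissible T F P (α i)) →
      Admissible T F P β → ∀ j, Admissible T F P (Function.update α i β j) := by
    intro i α β hα hβ j
    by_cases h : j = i
    · subst h; simpa using hβ
    · simpa [h] using hα j
  obtain ⟨U, hUV, hUN, huniq⟩ := abs_nash (lpMeas ℝ ℝ (progM F) 2 (nuT T P))
    (fun i j => KL (hB' i j)) (fun i j => KL (kernel_adj (hBbar' i j))) lam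
    (fun i j k => KL (hC' i j k)) (fun i j => cls T P (b i j)) (fun i => ∫ ω, c i ω ∂P)
    (by
      intro i u v
      have h : ∀ (G : ℝ → ℝ → ℝ) (hG : IsL2Kernel T G), G = B i i →
          inner ℝ u (KL (kernel_adj hG) v) = inner ℝ (KL (hB' i i) u) v := by
        intro G hG hGB
        subst hGB
        exact KL_adj hG u v
      exact h _ (hBbar' i i) (hdiag i))
    c₀ hc₀ (coerc_lift P T B Bbar lam hB' hBbar' c₀ hcoerc)
    (fun i => cls_mem (hb i i).1 (hb i i).2)
  choose α hα hαU using fun i => exists_rep (U i) (hUV i)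
  have hαU' : (fun j => cls T P (α j)) = U := funext hαU
  refine ⟨α, ⟨hα, ?_⟩, ?_⟩
  · intro i β hβ
    rw [hJ i α hα, hJ i _ (hupa i α β hα hβ), hupd, hαU']
    exact hUN i _ (cls_mem hβ.1 hβ.2)
  · intro γ hγ i
    have h := huniq (fun j => cls T P (γ j)) (fun j => cls_mem (hγ.1 j).1 (hγ.1 j).2) (by
      intro k w hw
      obtain ⟨β, hβ, rfl⟩ := exists_rep w hw
      have h := hγ.2 k β hβ
      rw [hJ k γ hγ.1, hJ k _ (hupa k γ β hγ.1 hβ), hupd] at h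
      exact h) i
    have m1 := adm_memLp (hα i).1 (hα i).2
    have m2 := adm_memLp (hγ.1 i).1 (hγ.1 i).2
    rw [← hαU i] at h
    simp only [cls_eq m1, cls_eq m2] at h
    exact (MemLp.toLp_eq_toLp_iff m1 m2).1 h
end
end

section
/- Under Assumptions (G3) and (G4), there exists a graphon game Nash equilibrium α̂∈𝒜^∞, and it is unique up to dℙ⊗dt⊗du-a.e. equality on Ω×[0,T]×[0,1]. -/
open MeasureTheory Set Filter

noncomputable section

variable {Ω : Type}

/-- A graphon: Borel-measurable, symmetric, `[0,1]`-valued. -/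
def IsGraphon (W : ℝ → ℝ → ℝ) : Prop :=
  Measurable (Function.uncurry W) ∧ (∀ u v, W u v = W v u) ∧ ∀ u v, W u v ∈ Icc (0:ℝ) 1

/-- Membership in `L²([0,T]×[0,1],ℝ)` (first variable: time, second variable: label). -/
def MemL2TI (T : ℝ) (g : ℝ → ℝ → ℝ) : Prop :=
  Measurable (Function.uncurry g) ∧
    Integrable (fun p : ℝ × ℝ => (g p.1 p.2) ^ 2)
      ((volume.restrict (Icc (0:ℝ) T)).prod (volume.restrict (Icc (0:ℝ) 1)))

/-- Objective functional `J^{u,W}` of player `u` in the graphon game. -/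
def Jgr (T : ℝ) {mΩ : MeasurableSpace Ω} (P : Measure Ω)
    (Atil Btil Ctil : ℝ → ℝ → ℝ) (lam : ℝ) (W : ℝ → ℝ → ℝ)
    (b : ℝ → ℝ → Ω → ℝ) (bstar : ℝ → Ω → ℝ) (c : ℝ → Ω → ℝ)
    (u : ℝ) (α : ℝ → ℝ → Ω → ℝ) : ℝ :=
  ∫ ω,
    (- ip T (fun t => α u t ω)
        (fun t => opK T Atil (fun s => α u s ω) t + lam * α u t ω)
      - ip T (fun t => α u t ω)
          (fun t => opK T Btil (fun s => ∫ v in Icc (0:ℝ) 1, W u v * α v s ω) t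
            + opKadj T Btil (fun s => ∫ v in Icc (0:ℝ) 1, W u v * α v s ω) t)
      - ip T (fun t => ∫ v in Icc (0:ℝ) 1, W u v * α v t ω)
          (opK T Ctil (fun s => ∫ v in Icc (0:ℝ) 1, W u v * α v s ω))
      + ip T (fun t => b u t ω) (fun t => α u t ω)
      + ip T (fun t => bstar t ω) (fun t => ∫ v in Icc (0:ℝ) 1, W u v * α v t ω)
      + c u ω) ∂P

/-- Admissible strategy profile of the graphon game. -/
def AdmProfile (T : ℝ) {mΩ : MeasurableSpace Ω} (F : Filtration ℝ mΩ) (P : Measure Ω)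
    (α : ℝ → ℝ → Ω → ℝ) : Prop :=
  Measurable (fun q : ℝ × ℝ × Ω => α q.1 q.2.1 q.2.2) ∧
    (∀ u ∈ Icc (0:ℝ) 1, ProgMeasurable F (α u)) ∧
    (∀ᵐ u ∂(volume.restrict (Icc (0:ℝ) 1)), SqInt T P (α u)) ∧
    Integrable (fun q : ℝ × ℝ × Ω => (α q.1 q.2.1 q.2.2) ^ 2)
      ((volume.restrict (Icc (0:ℝ) 1)).prod ((volume.restrict (Icc (0:ℝ) T)).prod P))

/-- Graphon game Nash equilibrium: for a.e. label `u`, the control `α u` maximizes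
the objective of player `u` among all admissible deviations. -/
def IsGraphonNash (T : ℝ) {mΩ : MeasurableSpace Ω} (F : Filtration ℝ mΩ) (P : Measure Ω)
    (Atil Btil Ctil : ℝ → ℝ → ℝ) (lam : ℝ) (W : ℝ → ℝ → ℝ)
    (b : ℝ → ℝ → Ω → ℝ) (bstar : ℝ → Ω → ℝ) (c : ℝ → Ω → ℝ)
    (α : ℝ → ℝ → Ω → ℝ) : Prop :=
  AdmProfile T F P α ∧
    ∀ᵐ u ∂(volume.restrict (Icc (0:ℝ) 1)),
      ∀ β : ℝ → Ω → ℝ, ProgMeasurable F β → SqInt T P β →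
        Jgr T P Atil Btil Ctil lam W b bstar c u (Function.update α u β)
          ≤ Jgr T P Atil Btil Ctil lam W b bstar c u α

section KOsec
open scoped ENNReal RealInnerProductSpace

theorem gn_ae_snd {S Y : Type*} [MeasurableSpace S] [MeasurableSpace Y]
    {σ : Measure S} {ρ : Measure Y} [SFinite σ] [SFinite ρ] {q : Y → Prop} (h : ∀ᵐ y ∂ρ, q y) :
    ∀ᵐ p ∂(σ.prod ρ), q p.2 :=
  Measure.quasiMeasurePreserving_snd.ae h

theorem gn_ae_fst {S Y : Type*} [MeasurableSpace S] [MeasurableSpace Y]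
    {σ : Measure S} {ρ : Measure Y} [SFinite σ] [SFinite ρ] {q : S → Prop} (h : ∀ᵐ y ∂σ, q y) :
    ∀ᵐ p ∂(σ.prod ρ), q p.1 :=
  Measure.quasiMeasurePreserving_fst.ae h

theorem gn_ae_symm {S Y : Type*} [MeasurableSpace S] [MeasurableSpace Y]
    {σ : Measure S} {ρ : Measure Y} [SFinite σ] [SFinite ρ] {q : S × Y → Prop}
    (h : ∀ᵐ p ∂(σ.prod ρ), q p) : ∀ᵐ y ∂ρ, ∀ᵐ s ∂σ, q (s, y) := by
  have h2 : ∀ᵐ p ∂(ρ.prod σ), q p.swap := by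
    have := (Measure.measurePreserving_swap (μ := ρ) (ν := σ)).quasiMeasurePreserving.ae h
    exact this
  exact Measure.ae_ae_of_ae_prod h2

theorem gn_memLp_right {S Y : Type*} [MeasurableSpace S] [MeasurableSpace Y]
    {σ : Measure S} {ρ : Measure Y} [SFinite σ] [SFinite ρ] {f : S × Y → ℝ}
    (hf : MemLp f 2 (σ.prod ρ)) : ∀ᵐ s ∂σ, MemLp (fun y => f (s, y)) 2 ρ := by
  have h1 := (hf.integrable_sq).prod_right_ae
  have h2 := hf.1.prodMk_left
  filter_upwards [h1, h2] with s a b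
  exact (memLp_two_iff_integrable_sq b).2 a

theorem gn_memLp_left {S Y : Type*} [MeasurableSpace S] [MeasurableSpace Y]
    {σ : Measure S} {ρ : Measure Y} [SFinite σ] [SFinite ρ] {f : S × Y → ℝ}
    (hf : MemLp f 2 (σ.prod ρ)) : ∀ᵐ y ∂ρ, MemLp (fun s => f (s, y)) 2 σ :=
  gn_memLp_right (f := fun p => f p.swap)
    (hf.comp_measurePreserving Measure.measurePreserving_swap)

/-- Fibrewise kernel operator. -/
def KO {S Y : Type*} [MeasurableSpace S] (σ : Measure S) (k : S → S → ℝ) (f : S × Y → ℝ) :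
    S × Y → ℝ := fun p => ∫ s', k p.1 s' * f (s', p.2) ∂σ

variable {S Y : Type*} [MeasurableSpace S] [MeasurableSpace Y]
    {σ : Measure S} {ρ : Measure Y} [SFinite σ] [SFinite ρ] {k : S → S → ℝ}

theorem KO_congr {f g : S × Y → ℝ} (h : f =ᵐ[σ.prod ρ] g) :
    KO σ k f =ᵐ[σ.prod ρ] KO σ k g := by
  filter_upwards [gn_ae_snd (gn_ae_symm h)] with p hp
  apply integral_congr_ae
  filter_upwards [hp] with s hs
  simp only [hs]

theorem KO_integrable (hk : MemLp (Function.uncurry k) 2 (σ.prod σ)) {f : S × Y → ℝ}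
    (hf : MemLp f 2 (σ.prod ρ)) :
    ∀ᵐ p ∂(σ.prod ρ), Integrable (fun s' => k p.1 s' * f (s', p.2)) σ := by
  filter_upwards [gn_ae_fst (gn_memLp_right hk), gn_ae_snd (gn_memLp_left hf)] with p h1 h2
  exact h1.integrable_mul h2

theorem KO_aesm (hkm : Measurable (Function.uncurry k)) {f : S × Y → ℝ}
    (hf : AEStronglyMeasurable f (σ.prod ρ)) :
    AEStronglyMeasurable (KO σ k f) (σ.prod ρ) := by
  refine AEStronglyMeasurable.congr ?_ (KO_congr hf.ae_eq_mk).symm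
  have hm : Measurable (hf.mk f) := hf.stronglyMeasurable_mk.measurable
  have : StronglyMeasurable (fun q : (S × Y) × S => k q.1.1 q.2 * hf.mk f (q.2, q.1.2)) := by
    apply Measurable.stronglyMeasurable
    apply Measurable.mul
    · exact hkm.comp (by fun_prop : Measurable fun q : (S × Y) × S => (q.1.1, q.2))
    · exact hm.comp (by fun_prop)
  exact this.integral_prod_right'.aestronglyMeasurable

theorem KO_lint (hk : MemLp (Function.uncurry k) 2 (σ.prod σ)) {f : S × Y → ℝ}
    (hf : MemLp f 2 (σ.prod ρ)) :
    ∫⁻ p, ‖KO σ k f p‖ₑ ^ (2:ℝ) ∂(σ.prod ρ) ≤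
      (∫⁻ p, ‖Function.uncurry k p‖ₑ ^ (2:ℝ) ∂(σ.prod σ)) * ∫⁻ p, ‖f p‖ₑ ^ (2:ℝ) ∂(σ.prod ρ) := by
  have hk2 : AEMeasurable (fun p => ‖Function.uncurry k p‖ₑ ^ (2:ℝ)) (σ.prod σ) :=
    hk.1.enorm.pow_const _
  have hf2 : AEMeasurable (fun p => ‖f p‖ₑ ^ (2:ℝ)) (σ.prod ρ) := hf.1.enorm.pow_const _
  rw [lintegral_prod _ hk2, lintegral_prod_symm _ hf2, ← lintegral_prod_mul]
  · apply lintegral_mono_ae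
    filter_upwards [gn_ae_fst (gn_memLp_right hk), gn_ae_snd (gn_memLp_left hf)] with p h1 h2
    have e1 : ‖KO σ k f p‖ₑ ≤ ∫⁻ s', ‖k p.1 s'‖ₑ * ‖f (s', p.2)‖ₑ ∂σ := by
      refine (enorm_integral_le_lintegral_enorm _).trans (le_of_eq ?_)
      simp [enorm_mul]
    have e2 := ENNReal.lintegral_mul_le_Lp_mul_Lq σ (p := 2) (q := 2) Real.HolderConjugate.two_two
      h1.1.enorm h2.1.enorm
    simp only [Pi.mul_apply] at e2
    have e3 := ENNReal.rpow_le_rpow (e1.trans e2) (z := 2) (by norm_num)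
    rw [ENNReal.mul_rpow_of_nonneg _ _ (by norm_num), ← ENNReal.rpow_mul, ← ENNReal.rpow_mul] at e3
    norm_num at e3 ⊢
    exact e3
  · exact hk2.lintegral_prod_right'
  · exact hf2.prod_swap.lintegral_prod_right'

theorem KO_eLpNorm (hk : MemLp (Function.uncurry k) 2 (σ.prod σ)) {f : S × Y → ℝ}
    (hf : MemLp f 2 (σ.prod ρ)) :
    eLpNorm (KO σ k f) 2 (σ.prod ρ) ≤
      eLpNorm (Function.uncurry k) 2 (σ.prod σ) * eLpNorm f 2 (σ.prod ρ) := by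
  simp only [eLpNorm_eq_lintegral_rpow_enorm_toReal (p := 2) (by norm_num) (by norm_num)]
  rw [← ENNReal.mul_rpow_of_nonneg _ _ (by norm_num)]
  apply ENNReal.rpow_le_rpow _ (by norm_num)
  simpa using KO_lint hk hf

theorem KO_memLp (hkm : Measurable (Function.uncurry k))
    (hk : MemLp (Function.uncurry k) 2 (σ.prod σ)) {f : S × Y → ℝ}
    (hf : MemLp f 2 (σ.prod ρ)) : MemLp (KO σ k f) 2 (σ.prod ρ) :=
  ⟨KO_aesm hkm hf.1, (KO_eLpNorm hk hf).trans_lt (ENNReal.mul_lt_top hk.2 hf.2)⟩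

/-- The kernel operator on `L²`. -/
def KOc (ρ : Measure Y) [SFinite ρ] (hkm : Measurable (Function.uncurry k))
    (hk : MemLp (Function.uncurry k) 2 (σ.prod σ)) :
    Lp ℝ 2 (σ.prod ρ) →L[ℝ] Lp ℝ 2 (σ.prod ρ) :=
  LinearMap.mkContinuous
    { toFun := fun f => (KO_memLp hkm hk (Lp.memLp f)).toLp
      map_add' := by
        intro f g
        rw [← MemLp.toLp_add, MemLp.toLp_eq_toLp_iff]
        filter_upwards [KO_congr (k := k) (Lp.coeFn_add f g), KO_integrable hk (Lp.memLp f),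
          KO_integrable hk (Lp.memLp g)] with p h1 h2 h3
        rw [h1]
        simp only [KO, Pi.add_apply, mul_add]
        rw [integral_add h2 h3]
      map_smul' := by
        intro c f
        simp only [RingHom.id_apply]
        rw [← MemLp.toLp_const_smul, MemLp.toLp_eq_toLp_iff]
        filter_upwards [KO_congr (k := k) (Lp.coeFn_smul c f)] with p h1
        rw [h1]
        simp only [KO, Pi.smul_apply, smul_eq_mul]
        rw [← integral_const_mul]
        congr 1
        ext s
        ring }
    (eLpNorm (Function.uncurry k) 2 (σ.prod σ)).toReal (by
      intro f
      simp only [LinearMap.coe_mk, AddHom.coe_mk, Lp.norm_toLp]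
      rw [Lp.norm_def, ← ENNReal.toReal_mul]
      exact ENNReal.toReal_mono (ENNReal.mul_lt_top hk.2 (Lp.memLp f).2).ne
        (KO_eLpNorm hk (Lp.memLp f)))

theorem KOc_coe (hkm : Measurable (Function.uncurry k))
    (hk : MemLp (Function.uncurry k) 2 (σ.prod σ)) (f : Lp ℝ 2 (σ.prod ρ)) :
    KOc ρ hkm hk f =ᵐ[σ.prod ρ] KO σ k f :=
  (KO_memLp hkm hk (Lp.memLp f)).coeFn_toLp

theorem KOc_toLp (hkm : Measurable (Function.uncurry k))
    (hk : MemLp (Function.uncurry k) 2 (σ.prod σ)) {f : S × Y → ℝ} (hf : MemLp f 2 (σ.prod ρ)) :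
    KOc ρ hkm hk hf.toLp = (KO_memLp hkm hk hf).toLp := by
  apply Lp.ext
  filter_upwards [KOc_coe (ρ := ρ) hkm hk hf.toLp, (KO_memLp hkm hk hf).coeFn_toLp,
    KO_congr (k := k) hf.coeFn_toLp] with p h1 h2 h3
  rw [h1, h2, h3]

theorem gn_inner_def {X : Type*} [MeasurableSpace X] {μ : Measure X} (f g : Lp ℝ 2 μ) :
    ⟪f, g⟫ = ∫ x, f x * g x ∂μ := by
  rw [L2.inner_def]
  congr 1
  ext x
  simp [mul_comm]

theorem gn_inner_toLp {X : Type*} [MeasurableSpace X] {μ : Measure X} {f g : X → ℝ}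
    (hf : MemLp f 2 μ) (hg : MemLp g 2 μ) :
    ⟪hf.toLp, hg.toLp⟫ = ∫ x, f x * g x ∂μ := by
  rw [gn_inner_def]
  apply integral_congr_ae
  filter_upwards [hf.coeFn_toLp, hg.coeFn_toLp] with x h1 h2
  rw [h1, h2]

theorem gn_swap_memLp (hk : MemLp (Function.uncurry k) 2 (σ.prod σ)) :
    MemLp (Function.uncurry fun t s => k s t) 2 (σ.prod σ) :=
  hk.comp_measurePreserving Measure.measurePreserving_swap

theorem gn_swap_meas (hkm : Measurable (Function.uncurry k)) :
    Measurable (Function.uncurry fun t s => k s t) :=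
  hkm.comp measurable_swap

theorem gn_tensor {S' : Type*} [MeasurableSpace S'] {σ' : Measure S'} [SFinite σ']
    {f : S → ℝ} {g : S' → ℝ} (hf : MemLp f 2 σ) (hg : MemLp g 2 σ') :
    MemLp (fun p : S × S' => f p.1 * g p.2) 2 (σ.prod σ') := by
  rw [memLp_two_iff_integrable_sq]
  · simp only [mul_pow]
    exact hf.integrable_sq.mul_prod hg.integrable_sq
  · exact hf.1.comp_fst.mul hg.1.comp_snd

theorem KO_adj (hkm : Measurable (Function.uncurry k))
    (hk : MemLp (Function.uncurry k) 2 (σ.prod σ)) {f g : S × Y → ℝ}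
    (hf : MemLp f 2 (σ.prod ρ)) (hg : MemLp g 2 (σ.prod ρ)) :
    ∫ p, g p * KO σ k f p ∂(σ.prod ρ) =
      ∫ p, KO σ (fun t s => k s t) g p * f p ∂(σ.prod ρ) := by
  rw [integral_prod_symm (fun p => g p * KO σ k f p) (hg.integrable_mul (KO_memLp hkm hk hf)),
    integral_prod_symm (fun p => KO σ (fun t s => k s t) g p * f p) ((KO_memLp (gn_swap_meas hkm) (gn_swap_memLp hk) hg).integrable_mul hf)]
  apply integral_congr_ae
  filter_upwards [gn_memLp_left hf, gn_memLp_left hg] with y h1 h2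
  simp only [KO, ← integral_const_mul, ← integral_mul_const]
  rw [integral_integral_swap]
  · congr 1; ext s; congr 1; ext t; ring
  · have := hk.integrable_mul (gn_tensor h2 h1)
    refine this.congr (Eventually.of_forall ?_)
    rintro ⟨s, t⟩
    simp only [Function.uncurry, Pi.mul_apply]
    ring

theorem KOc_adj (hkm : Measurable (Function.uncurry k))
    (hk : MemLp (Function.uncurry k) 2 (σ.prod σ)) (f g : Lp ℝ 2 (σ.prod ρ)) :
    ⟪g, KOc ρ hkm hk f⟫ = ⟪KOc ρ (gn_swap_meas hkm) (gn_swap_memLp hk) g, f⟫ := by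
  rw [gn_inner_def, gn_inner_def]
  have := KO_adj hkm hk (Lp.memLp f) (Lp.memLp g)
  rw [integral_congr_ae (g := fun p => g p * KO σ k f p), this]
  · apply integral_congr_ae
    filter_upwards [KOc_coe (gn_swap_meas hkm) (gn_swap_memLp hk) g] with p hp
    rw [hp]
  · filter_upwards [KOc_coe hkm hk f] with p hp
    rw [hp]

end KOsec
section Sel
open scoped ENNReal RealInnerProductSpace Topology

variable {U X : Type*} [MeasurableSpace U] [MeasurableSpace X] {κ : Measure U} {ν : Measure X}
  [IsFiniteMeasure κ] [IsFiniteMeasure ν]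

theorem gn_sec_set (ν : Measure X) [IsFiniteMeasure ν] (S : Set (U × X)) (hS : MeasurableSet S) :
    StronglyMeasurable fun u : U => indicatorConstLp 2
      (measurable_prodMk_left hS : MeasurableSet (Prod.mk u ⁻¹' S)) (measure_ne_top ν _) (1:ℝ) := by
  classical
  have hadd : ∀ (A B : Set (U × X)) (hA : MeasurableSet A) (hB : MeasurableSet B), Disjoint A B →
      ∀ u : U, indicatorConstLp 2 (measurable_prodMk_left (hA.union hB) :
        MeasurableSet (Prod.mk u ⁻¹' (A ∪ B))) (measure_ne_top ν _) (1:ℝ) =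
        indicatorConstLp 2 (measurable_prodMk_left hA :
          MeasurableSet (Prod.mk u ⁻¹' A)) (measure_ne_top ν _) (1:ℝ) +
        indicatorConstLp 2 (measurable_prodMk_left hB :
          MeasurableSet (Prod.mk u ⁻¹' B)) (measure_ne_top ν _) (1:ℝ) := by
    intro A B hA hB hd u
    exact indicatorConstLp_disjoint_union (measurable_prodMk_left hA) (measurable_prodMk_left hB)
      (measure_ne_top ν _) (measure_ne_top ν _) (hd.preimage _) (1:ℝ)
  induction S, hS using MeasurableSpace.induction_on_inter generateFrom_prod.symm isPiSystem_prod with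
  | empty =>
    simp only [preimage_empty, indicatorConstLp_empty]
    exact stronglyMeasurable_const
  | basic S hS =>
    obtain ⟨A, hA, B, hB, rfl⟩ := hS
    have hA' : MeasurableSet A := hA
    have hB' : MeasurableSet B := hB
    have : StronglyMeasurable (A.indicator fun _ : U =>
        indicatorConstLp 2 hB' (measure_ne_top ν _) (1:ℝ)) :=
      stronglyMeasurable_const.indicator hA'
    convert! this using 1
    ext1 u
    by_cases hu : u ∈ A
    · simp only [indicator_of_mem hu]
      congr 1
      exact mk_preimage_prod_right hu
    · simp only [indicator_of_notMem hu, mk_preimage_prod_right_eq_empty hu,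
        indicatorConstLp_empty]
  | compl S hS ih =>
    have : StronglyMeasurable fun u : U =>
      indicatorConstLp 2 (MeasurableSet.univ) (measure_ne_top ν _) (1:ℝ) -
        indicatorConstLp 2 (measurable_prodMk_left hS :
          MeasurableSet (Prod.mk u ⁻¹' S)) (measure_ne_top ν _) (1:ℝ) :=
      stronglyMeasurable_const.sub ih
    convert! this using 1
    ext1 u
    rw [eq_sub_iff_add_eq, ← hadd _ _ hS.compl hS disjoint_compl_left]
    congr 1
    simp
  | iUnion f hd hfm ih =>
    have hacc : ∀ n, MeasurableSet (accumulate f n) := fun n =>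
      MeasurableSet.biUnion (to_countable _) fun i _ => hfm i
    have h1 : ∀ n, StronglyMeasurable fun u : U => indicatorConstLp 2
      (measurable_prodMk_left (hacc n) : MeasurableSet (Prod.mk u ⁻¹' (accumulate f n)))
        (measure_ne_top ν _) (1:ℝ) := by
      intro n
      induction n with
      | zero => simpa only [accumulate_zero_nat] using ih 0
      | succ n ihn =>
        simp only [accumulate_succ]
        convert! ihn.add (ih (n+1)) using 1
        ext1 u
        exact hadd _ _ (hacc n) (hfm (n+1)) (disjoint_accumulate hd (Nat.lt_succ_self n)) u
    refine stronglyMeasurable_of_tendsto (f := fun n (u : U) => indicatorConstLp 2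
      (measurable_prodMk_left (hacc n) : MeasurableSet (Prod.mk u ⁻¹' (accumulate f n)))
        (measure_ne_top ν _) (1:ℝ)) atTop h1 ?_
    rw [tendsto_pi_nhds]
    intro u
    apply tendsto_indicatorConstLp_set (by norm_num)
    have h2 := tendsto_measure_iUnion_accumulate (μ := ν) (f := fun i => Prod.mk u ⁻¹' (f i))
    have h3 : ∀ n, accumulate (fun i => Prod.mk u ⁻¹' (f i)) n = Prod.mk u ⁻¹' (accumulate f n) := by
      intro n; simp [accumulate_def]
    simp only [h3] at h2
    have h4 : ∀ n, symmDiff (Prod.mk u ⁻¹' (accumulate f n)) (Prod.mk u ⁻¹' (⋃ i, f i)) =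
        (⋃ i, Prod.mk u ⁻¹' (f i)) \ (Prod.mk u ⁻¹' (accumulate f n)) := by
      intro n
      rw [← preimage_iUnion]
      apply symmDiff_of_le
      exact preimage_mono (accumulate_subset_iUnion n)
    simp only [h4]
    have h5 : ∀ n, ν ((⋃ i, Prod.mk u ⁻¹' (f i)) \ (Prod.mk u ⁻¹' (accumulate f n))) =
       ν (⋃ i, Prod.mk u ⁻¹' (f i)) - ν (Prod.mk u ⁻¹' (accumulate f n)) := by
      intro n
      apply measure_sdiff _ (measurable_prodMk_left (hacc n)).nullMeasurableSet (measure_ne_top _ _)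
      rw [← preimage_iUnion]
      exact preimage_mono (accumulate_subset_iUnion n)
    simp only [h5]
    have := ENNReal.Tendsto.sub (tendsto_const_nhds (x := ν (⋃ i, Prod.mk u ⁻¹' (f i)))) h2
      (Or.inl (measure_ne_top _ _))
    simpa using this

open Classical in
/-- The `L²` class of the section of a function. -/
def secLp (ν : Measure X) (Φ : U × X → ℝ) (u : U) : Lp ℝ 2 ν :=
  if h : MemLp (fun x => Φ (u, x)) 2 ν then h.toLp else 0

theorem secLp_eq {Φ : U × X → ℝ} {u : U} (h : MemLp (fun x => Φ (u, x)) 2 ν) :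
    secLp ν Φ u = h.toLp := by
  simp only [secLp, dif_pos h]

theorem gn_simple_memLp (Φ : SimpleFunc (U × X) ℝ) (u : U) :
    MemLp (fun x => Φ (u, x)) 2 ν := by
  obtain ⟨C, hC⟩ := Φ.exists_forall_norm_le
  exact MemLp.of_bound ((Φ.measurable.comp measurable_prodMk_left).aestronglyMeasurable) C
    (Eventually.of_forall fun x => hC _)

theorem gn_sec_simple (ν : Measure X) [IsFiniteMeasure ν] (Φ : SimpleFunc (U × X) ℝ) :
    StronglyMeasurable (secLp ν Φ : U → _) := by
  induction Φ using SimpleFunc.induction with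
  | const c hs =>
    rename_i s
    convert! (gn_sec_set ν s hs).const_smul c using 1
    ext1 u
    rw [secLp_eq (gn_simple_memLp _ u)]
    simp only [Pi.smul_apply]
    rw [indicatorConstLp, ← MemLp.toLp_const_smul, MemLp.toLp_eq_toLp_iff]
    refine Eventually.of_forall fun x => ?_
    by_cases hx : (u, x) ∈ s <;> simp [hx, SimpleFunc.piecewise_apply, indicator]
  | add hd hf hg =>
    rename_i f g
    convert! hf.add hg using 1
    ext1 u
    simp only [Pi.add_apply]
    rw [secLp_eq (gn_simple_memLp _ u), secLp_eq (gn_simple_memLp _ u),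
      secLp_eq (gn_simple_memLp _ u), ← MemLp.toLp_add, MemLp.toLp_eq_toLp_iff]
    exact Eventually.of_forall fun x => rfl

theorem gn_sec_aesm {Φ : U × X → ℝ} (hm : Measurable Φ) (hΦ : MemLp Φ 2 (κ.prod ν)) :
    AEStronglyMeasurable (secLp ν Φ) κ := by
  refine aestronglyMeasurable_of_tendsto_ae (atTop : Filter ℕ)
    (f := fun n => secLp ν (SimpleFunc.approxOn Φ hm univ 0 (mem_univ _) n))
    (fun n => (gn_sec_simple ν _).aestronglyMeasurable) ?_
  filter_upwards [gn_memLp_right hΦ] with u hu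
  rw [secLp_eq hu]
  simp only [secLp_eq (gn_simple_memLp _ u)]
  rw [Lp.tendsto_Lp_iff_tendsto_eLpNorm'']
  have hmu : Measurable fun x => Φ (u, x) := hm.comp measurable_prodMk_left
  have := SimpleFunc.tendsto_approxOn_Lp_eLpNorm (p := 2) hmu (mem_univ (0:ℝ)) (by norm_num)
    (μ := ν) (Eventually.of_forall fun x => by simp) (by simpa using hu.2)
  exact this

end Sel

section Sel2
open scoped ENNReal RealInnerProductSpace Topology

theorem gn_select {U X : Type*} [MeasurableSpace U] {m mX : MeasurableSpace X} {κ : Measure U}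
    {ν : Measure X} [IsFiniteMeasure κ] [IsFiniteMeasure ν] (hmle : m ≤ mX) {Φ : U × X → ℝ}
    (hΦ : MemLp Φ 2 (κ.prod ν))
    (h : ∀ (B : Set U) (g : X → ℝ), MeasurableSet B → StronglyMeasurable[m] g → MemLp g 2 ν →
      ∫ p, (B.indicator (fun _ => (1:ℝ)) p.1 * g p.2) * Φ p ∂(κ.prod ν) = 0) :
    ∀ᵐ u ∂κ, ∀ g : X → ℝ, StronglyMeasurable[m] g → MemLp g 2 ν →
      ∫ x, g x * Φ (u, x) ∂ν = 0 := by
  wlog hm : Measurable Φ generalizing Φ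
  · have hΦ' := (memLp_congr_ae hΦ.1.ae_eq_mk).1 hΦ
    have := this hΦ' (by
      intro B g hB hg hg2
      rw [← h B g hB hg hg2]
      apply integral_congr_ae
      filter_upwards [hΦ.1.ae_eq_mk] with p hp
      rw [hp]) hΦ.1.stronglyMeasurable_mk.measurable
    filter_upwards [this, Measure.ae_ae_of_ae_prod hΦ.1.ae_eq_mk] with u hu hu2 g hg hg2
    rw [← hu g hg hg2]
    apply integral_congr_ae
    filter_upwards [hu2] with x hx
    rw [hx]
  have : Fact (m ≤ mX) := ⟨hmle⟩
  let K : Submodule ℝ (Lp ℝ 2 ν) := lpMeas ℝ ℝ m 2 ν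
  have : CompleteSpace K := inferInstanceAs (CompleteSpace (lpMeas ℝ ℝ m 2 ν))
  have hV := gn_sec_aesm (κ := κ) hm hΦ
  have hsec := gn_memLp_right hΦ
  have key : ∀ g : X → ℝ, StronglyMeasurable[m] g → MemLp g 2 ν →
      ∀ᵐ u ∂κ, ∫ x, g x * Φ (u, x) ∂ν = 0 := by
    intro g hg hg2
    have hone : MemLp (fun _ : U => (1:ℝ)) 2 κ := memLp_const 1
    have hintg : Integrable (fun p : U × X => g p.2 * Φ p) (κ.prod ν) := by
      have := (gn_tensor hone hg2).integrable_mul hΦ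
      refine this.congr (Eventually.of_forall fun p => ?_)
      simp
    have hF : Integrable (fun u => ∫ x, g x * Φ (u, x) ∂ν) κ := hintg.integral_prod_left
    refine hF.ae_eq_zero_of_forall_setIntegral_eq_zero fun B hB _ => ?_
    have h0 := h B g hB hg hg2
    rw [← h0, integral_prod, ← integral_indicator hB]
    · congr 1
      ext u
      by_cases hu : u ∈ B <;> simp [hu]
    · have : MemLp (B.indicator fun _ : U => (1:ℝ)) 2 κ := hone.indicator hB
      exact (gn_tensor this hg2).integrable_mul hΦ
  have hPV : AEStronglyMeasurable (fun u => K.starProjection (secLp ν Φ u)) κ :=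
    K.starProjection.continuous.comp_aestronglyMeasurable hV
  obtain ⟨t, ht, ht2⟩ := hPV.isSeparable_ae_range
  have hzero := ae_eq_zero_of_forall_dual_of_isSeparable ℝ ht (f := fun u =>
    K.starProjection (secLp ν Φ u)) (μ := κ) (by
      intro c
      obtain ⟨w, rfl⟩ := (InnerProductSpace.toDual ℝ (Lp ℝ 2 ν)).surjective c
      have hw : K.starProjection w ∈ K := Submodule.starProjection_apply_mem _ _
      have hw2 := mem_lpMeas_iff_aestronglyMeasurable.1 hw
      obtain ⟨g, hg, hgw⟩ := hw2
      have hg2 : MemLp g 2 ν := (memLp_congr_ae hgw).1 (Lp.memLp _)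
      filter_upwards [key g hg hg2, hsec] with u hu hu2
      change ⟪w, K.starProjection (secLp ν Φ u)⟫ = 0
      rw [← Submodule.inner_starProjection_left_eq_right, gn_inner_def, ← hu]
      apply integral_congr_ae
      rw [secLp_eq hu2]
      filter_upwards [hgw, hu2.coeFn_toLp] with x h1 h2
      rw [h1, h2]) ht2
  filter_upwards [hzero, hsec] with u hu hu2 g hg hg2
  have h1 := (Submodule.starProjection_apply_eq_zero_iff (K := K)).1 hu
  have hgK : hg2.toLp ∈ K := mem_lpMeas_iff_aestronglyMeasurable.2 ⟨g, hg, hg2.coeFn_toLp⟩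
  have h2 := (Submodule.mem_orthogonal K _).1 h1 _ hgK
  rw [gn_inner_def] at h2
  rw [← h2]
  apply integral_congr_ae
  rw [secLp_eq hu2]
  filter_upwards [hg2.coeFn_toLp, hu2.coeFn_toLp] with x h1 h2
  rw [h1, h2]

end Sel2
section Abs
open scoped RealInnerProductSpace

theorem gn_opt {E : Type*} [NormedAddCommGroup E] [InnerProductSpace ℝ E] (A A' : E →L[ℝ] E)
    (hadj : ∀ f g, ⟪g, A f⟫ = ⟪A' g, f⟫) (hpos : ∀ f, 0 ≤ ⟪f, A f⟫) {lam : ℝ} (hlam : 0 < lam)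
    (w f : E) (U : Submodule ℝ E) (hf : f ∈ U) :
    (∀ g ∈ U, -⟪g, A g + lam • g⟫ + ⟪w, g⟫ ≤ -⟪f, A f + lam • f⟫ + ⟪w, f⟫) ↔
      ∀ h ∈ U, ⟪h, (2 * lam) • f + A f + A' f - w⟫ = 0 := by
  have key : ∀ h, -⟪f + h, A (f + h) + lam • (f + h)⟫ + ⟪w, f + h⟫ =
      -⟪f, A f + lam • f⟫ + ⟪w, f⟫ - ⟪h, (2 * lam) • f + A f + A' f - w⟫
        - (⟪h, A h⟫ + lam * ⟪h, h⟫) := by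
    intro h
    have h1 : ⟪f, A h⟫ = ⟪h, A' f⟫ := by rw [hadj, real_inner_comm]
    have h2 : ⟪f, h⟫ = ⟪h, f⟫ := real_inner_comm _ _
    have h3 : ⟪w, h⟫ = ⟪h, w⟫ := real_inner_comm _ _
    simp only [map_add, inner_add_left, inner_add_right, inner_sub_right, inner_smul_right,
      smul_add, h1, h2, h3]
    ring
  constructor
  · intro H h hh
    set g := ⟪h, (2 * lam) • f + A f + A' f - w⟫ with hg
    set c := ⟪h, A h⟫ + lam * ⟪h, h⟫ with hc
    have hc0 : 0 ≤ c := by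
      have := hpos h
      have h3 : 0 ≤ ⟪h, h⟫ := real_inner_self_nonneg
      positivity
    have h1 : ∀ ε : ℝ, 0 ≤ ε * g + ε ^ 2 * c := by
      intro ε
      have h2 := H (f + ε • h) (U.add_mem hf (U.smul_mem _ hh))
      rw [key] at h2
      simp only [map_smul, inner_smul_left, inner_smul_right] at h2
      simp only [conj_trivial] at h2
      rw [← hg] at h2
      have : ε * (ε * ⟪h, A h⟫) + lam * (ε * (ε * ⟪h, h⟫)) = ε ^ 2 * c := by rw [hc]; ring
      linarith
    have h2 := h1 (-g / (c + 1))
    have h3 : -g / (c + 1) * g + (-g / (c + 1)) ^ 2 * c = -(g / (c + 1)) ^ 2 := by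
      field_simp
      ring
    rw [h3] at h2
    have h4 : (g / (c + 1)) ^ 2 = 0 := le_antisymm (by linarith) (sq_nonneg _)
    have h5 := pow_eq_zero_iff (two_ne_zero) |>.1 h4
    rcases div_eq_zero_iff.1 h5 with h | h
    · exact h
    · linarith
  · intro H g hg
    have := key (g - f)
    rw [H _ (U.sub_mem hg hf)] at this
    simp only [add_sub_cancel] at this
    rw [this]
    have h1 := hpos (g - f)
    have h3 : 0 ≤ ⟪g - f, g - f⟫ := real_inner_self_nonneg
    have : 0 ≤ lam * ⟪g - f, g - f⟫ := by positivity
    linarith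

theorem gn_laxMilgram {E : Type*} [NormedAddCommGroup E] [InnerProductSpace ℝ E] [CompleteSpace E]
    (M : E →L[ℝ] E) {c : ℝ} (hc : 0 < c) (hM : ∀ f, c * ⟪f, f⟫ ≤ ⟪f, M f⟫)
    (H : Submodule ℝ E) [CompleteSpace H] (b : E) :
    ∃ f ∈ H, ∀ h ∈ H, ⟪h, M f - b⟫ = 0 := by
  let Mh : H →L[ℝ] H := H.orthogonalProjectionOnto.comp (M.comp H.subtypeL)
  let B : H →L[ℝ] H →L[ℝ] ℝ := (innerSL ℝ (E := H)).comp Mh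
  have hB : ∀ f g : H, B f g = ⟪M f, (g : E)⟫ := by
    intro f g
    change ⟪H.orthogonalProjectionOnto (M f), g⟫ = _
    rw [Submodule.inner_orthogonalProjectionOnto_eq_of_mem_right]
  have hco : IsCoercive B := by
    refine ⟨c, hc, fun u => ?_⟩
    rw [hB, real_inner_comm]
    refine le_trans (le_of_eq ?_) (hM u)
    rw [real_inner_self_eq_norm_sq]
    simp only [Submodule.coe_norm]
    ring
  obtain ⟨v, hv⟩ := hco.continuousLinearEquivOfBilin.surjective (H.orthogonalProjectionOnto b)
  refine ⟨v, v.2, fun h hh => ?_⟩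
  have h1 := hco.continuousLinearEquivOfBilin_apply v ⟨h, hh⟩
  rw [hv, hB, Submodule.inner_orthogonalProjectionOnto_eq_of_mem_right] at h1
  rw [inner_sub_right, real_inner_comm (M v) h, real_inner_comm b h]
  simp only at h1
  rw [h1]; ring

end Abs

section Prog
variable {Ω : Type} {mΩ : MeasurableSpace Ω}

/-- The progressive σ-algebra. -/
def progS (F : Filtration ℝ mΩ) : MeasurableSpace (ℝ × Ω) :=
  ⨅ t : ℝ, MeasurableSpace.map (fun p : Iic t × Ω => ((p.1 : ℝ), p.2))
    (@Prod.instMeasurableSpace _ _ Subtype.instMeasurableSpace (F t))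

theorem progS_iff (F : Filtration ℝ mΩ) (α : ℝ → Ω → ℝ) :
    ProgMeasurable F α ↔ StronglyMeasurable[progS F] (Function.uncurry α) := by
  have h1 : StronglyMeasurable[progS F] (Function.uncurry α) ↔
    Measurable[progS F] (Function.uncurry α) := ⟨fun h => h.measurable, fun h => h.stronglyMeasurable⟩
  have h2 : ProgMeasurable F α ↔ ∀ t : ℝ, Measurable[@Prod.instMeasurableSpace _ _
      Subtype.instMeasurableSpace (F t)] fun p : Iic t × Ω => α p.1 p.2 :=
    forall_congr' fun t => ⟨fun h => h.measurable, fun h => h.stronglyMeasurable⟩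
  rw [h1, h2]
  constructor
  · intro h s hs
    rw [progS, MeasurableSpace.measurableSet_iInf]
    intro t
    exact h t hs
  · intro h t s hs
    have := h hs
    rw [progS, MeasurableSpace.measurableSet_iInf] at this
    exact this t

theorem progS_le (F : Filtration ℝ mΩ) :
    progS F ≤ (Prod.instMeasurableSpace : MeasurableSpace (ℝ × Ω)) := by
  intro s hs
  rw [progS, MeasurableSpace.measurableSet_iInf] at hs
  have h1 : ∀ t : ℝ, MeasurableSet ((fun p : Iic t × Ω => ((p.1 : ℝ), p.2)) ⁻¹' s) := by
    intro t
    have h2 : (@Prod.instMeasurableSpace _ _ Subtype.instMeasurableSpace (F t) :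
      MeasurableSpace (Iic t × Ω)) ≤ Prod.instMeasurableSpace :=
      sup_le_sup le_rfl (MeasurableSpace.comap_mono (F.le t))
    exact h2 _ (hs t)
  have h3 : s = ⋃ n : ℕ, (fun p : Iic (n : ℝ) × Ω => ((p.1 : ℝ), p.2)) ''
      ((fun p : Iic (n : ℝ) × Ω => ((p.1 : ℝ), p.2)) ⁻¹' s) := by
    ext ⟨t, ω⟩
    simp only [mem_iUnion, mem_image, mem_preimage, Prod.exists]
    constructor
    · intro h
      obtain ⟨n, hn⟩ := exists_nat_ge t
      exact ⟨n, ⟨t, hn⟩, ω, h, rfl⟩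
    · rintro ⟨n, a, w, h, h'⟩
      rw [h'] at h
      exact h
  rw [h3]
  refine MeasurableSet.iUnion fun n => ?_
  have : MeasurableEmbedding (fun p : Iic (n : ℝ) × Ω => ((p.1 : ℝ), p.2)) :=
    (MeasurableEmbedding.subtype_coe measurableSet_Iic).prodMap MeasurableEmbedding.id
  exact this.measurableSet_image.2 (h1 n)

end Prog

section JJ
open scoped RealInnerProductSpace ENNReal

variable {Ω : Type} {mΩ : MeasurableSpace Ω} {P : Measure Ω} [IsProbabilityMeasure P] {T : ℝ}

theorem gn_ker {T : ℝ} {G : ℝ → ℝ → ℝ} (h : IsL2Kernel T G) :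
    MemLp (Function.uncurry G) 2
      ((volume.restrict (Icc (0:ℝ) T)).prod (volume.restrict (Icc (0:ℝ) T))) :=
  (memLp_two_iff_integrable_sq h.1.aestronglyMeasurable).2 h.2

theorem gn_ip {f g : ℝ × Ω → ℝ} (hf : MemLp f 2 ((volume.restrict (Icc (0:ℝ) T)).prod P))
    (hg : MemLp g 2 ((volume.restrict (Icc (0:ℝ) T)).prod P)) :
    Integrable (fun ω => ip T (fun t => f (t, ω)) (fun t => g (t, ω))) P ∧
      ∫ ω, ip T (fun t => f (t, ω)) (fun t => g (t, ω)) ∂P = ⟪hf.toLp, hg.toLp⟫ := by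
  have hi : Integrable (fun p => f p * g p) ((volume.restrict (Icc (0:ℝ) T)).prod P) :=
    hf.integrable_mul hg
  refine ⟨hi.integral_prod_right, ?_⟩
  rw [gn_inner_toLp, integral_prod_symm _ hi]
  rfl

theorem gn_int6 {a1 a2 a3 a4 a5 a6 : Ω → ℝ} (i1 : Integrable a1 P) (i2 : Integrable a2 P)
    (i3 : Integrable a3 P) (i4 : Integrable a4 P) (i5 : Integrable a5 P) (i6 : Integrable a6 P) :
    ∫ ω, ((-a1 ω - a2 ω + a4 ω) + (-a3 ω + a5 ω + a6 ω)) ∂P =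
      (-∫ ω, a1 ω ∂P) - (∫ ω, a2 ω ∂P) + (∫ ω, a4 ω ∂P)
        + ∫ ω, (-a3 ω + a5 ω + a6 ω) ∂P := by
  have h := integral_add (f := fun ω => -a1 ω - a2 ω + a4 ω) (g := fun ω => -a3 ω + a5 ω + a6 ω)
    ((i1.neg.sub i2).add i4) ((i3.neg.add i5).add i6)
  rw [h]
  congr 1
  have h := integral_add (f := fun ω => -a1 ω - a2 ω) (g := a4) (i1.neg.sub i2) i4
  rw [h]
  congr 1
  have h := integral_sub (f := fun ω => -a1 ω) (g := a2) i1.neg i2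
  rw [h, integral_neg]

/-- Part of the payoff which does not depend on the player's own control. -/
def Jconst (T : ℝ) (P : Measure Ω) (Ctil : ℝ → ℝ → ℝ) (z : ℝ × Ω → ℝ) (bstar : ℝ → Ω → ℝ)
    (c : Ω → ℝ) : ℝ :=
  ∫ ω, (- ip T (fun t => z (t, ω)) (fun t => KO (volume.restrict (Icc (0:ℝ) T)) Ctil z (t, ω))
    + ip T (fun t => bstar t ω) (fun t => z (t, ω)) + c ω) ∂P

theorem gn_J (Atil Btil Ctil : ℝ → ℝ → ℝ)
    (hA : IsL2Kernel T Atil) (hB : IsL2Kernel T Btil) (hC : IsL2Kernel T Ctil)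
    (lam : ℝ) (W : ℝ → ℝ → ℝ) (b : ℝ → ℝ → Ω → ℝ) (bstar : ℝ → Ω → ℝ) (c : ℝ → Ω → ℝ)
    (u : ℝ) (α : ℝ → ℝ → Ω → ℝ) (β : ℝ → Ω → ℝ) (z : ℝ × Ω → ℝ)
    (hzdef : z = fun p => ∫ v in Icc (0:ℝ) 1, W u v * α v p.1 p.2)
    (hz : MemLp z 2 ((volume.restrict (Icc (0:ℝ) T)).prod P))
    (hb : MemLp (Function.uncurry (b u)) 2 ((volume.restrict (Icc (0:ℝ) T)).prod P))
    (hbs : MemLp (Function.uncurry bstar) 2 ((volume.restrict (Icc (0:ℝ) T)).prod P))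
    (hc : Integrable (c u) P)
    (hβ : MemLp (Function.uncurry β) 2 ((volume.restrict (Icc (0:ℝ) T)).prod P)) :
    Jgr T P Atil Btil Ctil lam W b bstar c u (Function.update α u β) =
      -⟪hβ.toLp, KOc P hA.1 (gn_ker hA) hβ.toLp + lam • hβ.toLp⟫
      + ⟪hb.toLp - (KOc P hB.1 (gn_ker hB) hz.toLp +
          KOc P (gn_swap_meas hB.1) (gn_swap_memLp (gn_ker hB)) hz.toLp), hβ.toLp⟫
      + Jconst T P Ctil z bstar (c u) := by
  have hup : ∀ s ω, ∫ v in Icc (0:ℝ) 1, W u v * Function.update α u β v s ω = z (s, ω) := by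
    intro s ω
    rw [hzdef]
    apply integral_congr_ae
    have : ∀ᵐ v : ℝ ∂(volume.restrict (Icc (0:ℝ) 1)), v ≠ u :=
      ae_restrict_of_ae (Measure.ae_ne volume u)
    filter_upwards [this] with v hv
    rw [Function.update_of_ne hv]
  have hAm := KO_memLp hA.1 (gn_ker hA) hβ
  have hBm := KO_memLp hB.1 (gn_ker hB) hz
  have hBm' := KO_memLp (gn_swap_meas hB.1) (gn_swap_memLp (gn_ker hB)) hz
  have hCm := KO_memLp hC.1 (gn_ker hC) hz
  obtain ⟨i1, e1⟩ := gn_ip hβ (hAm.add (hβ.const_smul lam))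
  obtain ⟨i2, e2⟩ := gn_ip hβ (hBm.add hBm')
  obtain ⟨i3, e3⟩ := gn_ip hz hCm
  obtain ⟨i4, e4⟩ := gn_ip hb hβ
  obtain ⟨i5, e5⟩ := gn_ip hbs hz
  have hJ : Jgr T P Atil Btil Ctil lam W b bstar c u (Function.update α u β) =
    ∫ ω, ((- ip T (fun t => Function.uncurry β (t, ω))
        (fun t => (KO (volume.restrict (Icc (0:ℝ) T)) Atil (Function.uncurry β) +
          lam • Function.uncurry β) (t, ω))
      - ip T (fun t => Function.uncurry β (t, ω))
        (fun t => (KO (volume.restrict (Icc (0:ℝ) T)) Btil z +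
          KO (volume.restrict (Icc (0:ℝ) T)) (fun t s => Btil s t) z) (t, ω))
      + ip T (fun t => Function.uncurry (b u) (t, ω)) (fun t => Function.uncurry β (t, ω)))
      + (- ip T (fun t => z (t, ω)) (fun t => KO (volume.restrict (Icc (0:ℝ) T)) Ctil z (t, ω))
      + ip T (fun t => Function.uncurry bstar (t, ω)) (fun t => z (t, ω)) + c u ω)) ∂P := by
    unfold Jgr
    simp only [hup, Function.update_self]
    congr 1
    ext ω
    have a1 : opK T Ctil (fun s => z (s, ω)) =
      (fun t => KO (volume.restrict (Icc (0:ℝ) T)) Ctil z (t, ω)) := rfl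
    have a2 : (fun t => opK T Btil (fun s => z (s, ω)) t + opKadj T Btil (fun s => z (s, ω)) t) =
      (fun t => (KO (volume.restrict (Icc (0:ℝ) T)) Btil z +
          KO (volume.restrict (Icc (0:ℝ) T)) (fun t s => Btil s t) z) (t, ω)) := rfl
    have a3 : (fun t => opK T Atil (fun s => β s ω) t + lam * β t ω) =
      (fun t => (KO (volume.restrict (Icc (0:ℝ) T)) Atil (Function.uncurry β) +
          lam • Function.uncurry β) (t, ω)) := rfl
    rw [a1, a2, a3]
    simp only [Function.uncurry]
    ring
  rw [hJ, gn_int6 i1 i2 i3 i4 i5 hc, e1, e2, e4]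
  have : Jconst T P Ctil z bstar (c u) = ∫ ω, (- ip T (fun t => z (t, ω)) (fun t => KO (volume.restrict (Icc (0:ℝ) T)) Ctil z (t, ω))
      + ip T (fun t => Function.uncurry bstar (t, ω)) (fun t => z (t, ω)) + c u ω) ∂P := rfl
  rw [this]
  congr 1
  rw [KOc_toLp, KOc_toLp, KOc_toLp, MemLp.toLp_add hAm (hβ.const_smul lam), MemLp.toLp_add hBm hBm',
    MemLp.toLp_const_smul lam hβ,
    inner_sub_left, real_inner_comm (hβ.toLp) (MemLp.toLp _ hBm + MemLp.toLp _ hBm')]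
  ring

end JJ

section TT
open scoped RealInnerProductSpace ENNReal

variable {U S Ω : Type*} [MeasurableSpace U] [MeasurableSpace S] [MeasurableSpace Ω]
  {κ : Measure U} {σ : Measure S} {P : Measure Ω} [SFinite κ] [SFinite σ] [SFinite P]
  {k : S → S → ℝ}

/-- Exchange of the first two coordinates. -/
def gnsw {A B C : Type*} (p : A × (B × C)) : B × (A × C) := (p.2.1, (p.1, p.2.2))

theorem gnsw_mp (κ : Measure U) (σ : Measure S) (P : Measure Ω) [SFinite κ] [SFinite σ]
    [SFinite P] : MeasurePreserving (gnsw (A := U) (B := S) (C := Ω)) (κ.prod (σ.prod P))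
      (σ.prod (κ.prod P)) := by
  have h1 := (measurePreserving_prodAssoc κ σ P).symm
  have h2 : MeasurePreserving (Prod.map Prod.swap id : (U × S) × Ω → (S × U) × Ω)
      ((κ.prod σ).prod P) ((σ.prod κ).prod P) :=
    (Measure.measurePreserving_swap).prod (MeasurePreserving.id P)
  have h3 := measurePreserving_prodAssoc σ κ P
  exact h3.comp (h2.comp h1)

/-- The map `(ω, (u, t)) ↦ (u, (t, ω))` preserves measure. -/
theorem gnrot_mp (κ : Measure U) (σ : Measure S) (P : Measure Ω) [SFinite κ] [SFinite σ]
    [SFinite P] : MeasurePreserving (fun p : Ω × (U × S) => (p.2.1, (p.2.2, p.1)))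
      (P.prod (κ.prod σ)) (κ.prod (σ.prod P)) :=
  (measurePreserving_prodAssoc κ σ P).comp Measure.measurePreserving_swap

theorem gn_fub3 {F : U × (S × Ω) → ℝ} (hF : Integrable F (κ.prod (σ.prod P))) :
    Integrable (fun ω => ∫ u, ∫ t, F (u, (t, ω)) ∂σ ∂κ) P ∧
      ∫ q, F q ∂(κ.prod (σ.prod P)) = ∫ ω, ∫ u, ∫ t, F (u, (t, ω)) ∂σ ∂κ ∂P := by
  have mp := gnrot_mp κ σ P
  have h := mp.integrable_comp_of_integrable hF
  have e : ∀ᵐ ω ∂P, ∫ p : U × S, F (p.1, (p.2, ω)) ∂(κ.prod σ) =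
      ∫ u, ∫ t, F (u, (t, ω)) ∂σ ∂κ := by
    filter_upwards [h.prod_right_ae] with ω hω
    exact integral_prod _ hω
  have hi : Integrable (fun ω => ∫ p : U × S, F (p.1, (p.2, ω)) ∂(κ.prod σ)) P :=
    h.integral_prod_left
  refine ⟨hi.congr e, ?_⟩
  rw [← integral_congr_ae e, ← mp.map_eq, integral_map mp.measurable.aemeasurable]
  · exact integral_prod _ h
  · rw [mp.map_eq]; exact hF.1

theorem gn_sec3 {f : U × (S × Ω) → ℝ} (hf : MemLp f 2 (κ.prod (σ.prod P))) :
    ∀ᵐ ω ∂P, MemLp (fun p : U × S => f (p.1, (p.2, ω))) 2 (κ.prod σ) :=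
  gn_memLp_right (hf.comp_measurePreserving (gnrot_mp κ σ P))

/-- Kernel operator in the middle variable. -/
def TK (σ : Measure S) (k : S → S → ℝ) (f : U × (S × Ω) → ℝ) : U × (S × Ω) → ℝ :=
  fun q => ∫ s, k q.2.1 s * f (q.1, (s, q.2.2)) ∂σ

theorem TK_memLp (hkm : Measurable (Function.uncurry k))
    (hk : MemLp (Function.uncurry k) 2 (σ.prod σ)) {f : U × (S × Ω) → ℝ}
    (hf : MemLp f 2 (κ.prod (σ.prod P))) : MemLp (TK σ k f) 2 (κ.prod (σ.prod P)) := by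
  have h1 : MemLp (f ∘ gnsw) 2 (σ.prod (κ.prod P)) := hf.comp_measurePreserving (gnsw_mp σ κ P)
  exact (KO_memLp hkm hk h1).comp_measurePreserving (gnsw_mp κ σ P)

/-- Kernel operator in the middle variable on `L²`. -/
def TKc (κ : Measure U) (P : Measure Ω) [SFinite κ] [SFinite P]
    (hkm : Measurable (Function.uncurry k))
    (hk : MemLp (Function.uncurry k) 2 (σ.prod σ)) :
    Lp ℝ 2 (κ.prod (σ.prod P)) →L[ℝ] Lp ℝ 2 (κ.prod (σ.prod P)) :=
  (Lp.compMeasurePreservingₗᵢ ℝ gnsw (gnsw_mp κ σ P)).toContinuousLinearMap ∘L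
    (KOc (κ.prod P) hkm hk) ∘L
    (Lp.compMeasurePreservingₗᵢ ℝ gnsw (gnsw_mp σ κ P)).toContinuousLinearMap

theorem TKc_toLp (hkm : Measurable (Function.uncurry k))
    (hk : MemLp (Function.uncurry k) 2 (σ.prod σ)) {f : U × (S × Ω) → ℝ}
    (hf : MemLp f 2 (κ.prod (σ.prod P))) :
    TKc κ P hkm hk hf.toLp = (TK_memLp hkm hk hf).toLp := by
  have h1 : MemLp (f ∘ gnsw) 2 (σ.prod (κ.prod P)) := hf.comp_measurePreserving (gnsw_mp σ κ P)
  have e1 : Lp.compMeasurePreservingₗᵢ ℝ gnsw (gnsw_mp σ κ P) hf.toLp = h1.toLp :=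
    Lp.toLp_compMeasurePreserving hf _
  have e2 : Lp.compMeasurePreservingₗᵢ ℝ gnsw (gnsw_mp κ σ P) (KO_memLp hkm hk h1).toLp =
      (TK_memLp hkm hk hf).toLp :=
    Lp.toLp_compMeasurePreserving (KO_memLp hkm hk h1) _
  rw [← e2, ← KOc_toLp hkm hk h1, ← e1]
  rfl

theorem gnsw_inv (f : Lp ℝ 2 (κ.prod (σ.prod P))) :
    Lp.compMeasurePreservingₗᵢ ℝ gnsw (gnsw_mp κ σ P)
      (Lp.compMeasurePreservingₗᵢ ℝ gnsw (gnsw_mp σ κ P) f) = f := by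
  have hf := Lp.memLp f
  have h1 : MemLp (f ∘ gnsw) 2 (σ.prod (κ.prod P)) := hf.comp_measurePreserving (gnsw_mp σ κ P)
  have e1 : Lp.compMeasurePreservingₗᵢ ℝ gnsw (gnsw_mp σ κ P) hf.toLp = h1.toLp :=
    Lp.toLp_compMeasurePreserving hf _
  have e2 : Lp.compMeasurePreservingₗᵢ ℝ gnsw (gnsw_mp κ σ P) h1.toLp = hf.toLp :=
    Lp.toLp_compMeasurePreserving h1 _
  rw [Lp.toLp_coeFn f hf] at e1 e2
  rw [e1, e2]

theorem TKc_adj (hkm : Measurable (Function.uncurry k))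
    (hk : MemLp (Function.uncurry k) 2 (σ.prod σ)) (f g : Lp ℝ 2 (κ.prod (σ.prod P))) :
    ⟪g, TKc κ P hkm hk f⟫ = ⟪TKc κ P (gn_swap_meas hkm) (gn_swap_memLp hk) g, f⟫ := by
  have e1 : TKc κ P hkm hk f = Lp.compMeasurePreservingₗᵢ ℝ gnsw (gnsw_mp κ σ P)
    (KOc (κ.prod P) hkm hk (Lp.compMeasurePreservingₗᵢ ℝ gnsw (gnsw_mp σ κ P) f)) := rfl
  have e2 : TKc κ P (gn_swap_meas hkm) (gn_swap_memLp hk) g =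
    Lp.compMeasurePreservingₗᵢ ℝ gnsw (gnsw_mp κ σ P)
    (KOc (κ.prod P) (gn_swap_meas hkm) (gn_swap_memLp hk)
      (Lp.compMeasurePreservingₗᵢ ℝ gnsw (gnsw_mp σ κ P) g)) := rfl
  rw [e1, e2]
  nth_rewrite 1 [← gnsw_inv g]
  nth_rewrite 2 [← gnsw_inv f]
  rw [LinearIsometry.inner_map_map, LinearIsometry.inner_map_map, KOc_adj]

theorem gn_comm {W : U → U → ℝ} (hWm : Measurable (Function.uncurry W))
    (hW : MemLp (Function.uncurry W) 2 (κ.prod κ)) (hkm : Measurable (Function.uncurry k))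
    (hk : MemLp (Function.uncurry k) 2 (σ.prod σ)) {f : U × (S × Ω) → ℝ}
    (hf : MemLp f 2 (κ.prod (σ.prod P))) :
    KO κ W (TK σ k f) =ᵐ[κ.prod (σ.prod P)] TK σ k (KO κ W f) := by
  filter_upwards [gn_ae_fst (gn_memLp_right hW), gn_ae_snd (gn_ae_fst (gn_memLp_right hk)),
    gn_ae_snd (gn_ae_snd (gn_sec3 hf))] with q h1 h2 h3
  simp only [KO, TK, ← integral_const_mul]
  rw [integral_integral_swap]
  · congr 1; ext s; congr 1; ext t; ring
  · refine ((gn_tensor h1 h2).integrable_mul h3).congr (Eventually.of_forall ?_)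
    rintro ⟨s, t⟩
    simp only [Function.uncurry, Pi.mul_apply]
    ring

theorem gn_commc {W : U → U → ℝ} (hWm : Measurable (Function.uncurry W))
    (hW : MemLp (Function.uncurry W) 2 (κ.prod κ)) (hkm : Measurable (Function.uncurry k))
    (hk : MemLp (Function.uncurry k) 2 (σ.prod σ)) (f : Lp ℝ 2 (κ.prod (σ.prod P))) :
    KOc (σ.prod P) hWm hW (TKc κ P hkm hk f) = TKc κ P hkm hk (KOc (σ.prod P) hWm hW f) := by
  have hf := Lp.memLp f
  rw [← Lp.toLp_coeFn f hf, KOc_toLp, TKc_toLp, KOc_toLp, TKc_toLp, MemLp.toLp_eq_toLp_iff]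
  exact gn_comm hWm hW hkm hk hf

/-- The symmetrised equilibrium operator is coercive. -/
theorem gn_symm_inner {W : U → U → ℝ} (hWm : Measurable (Function.uncurry W))
    (hW : MemLp (Function.uncurry W) 2 (κ.prod κ)) (hWs : ∀ u v, W u v = W v u)
    {A B : S → S → ℝ} (hAm : Measurable (Function.uncurry A))
    (hA : MemLp (Function.uncurry A) 2 (σ.prod σ)) (hBm : Measurable (Function.uncurry B))
    (hB : MemLp (Function.uncurry B) 2 (σ.prod σ)) (lam : ℝ) (f : Lp ℝ 2 (κ.prod (σ.prod P))) :
    ⟪f, (2 * lam) • f + TKc κ P hAm hA f + TKc κ P (gn_swap_meas hAm) (gn_swap_memLp hA) f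
      + (TKc κ P hBm hB (KOc (σ.prod P) hWm hW f)
        + TKc κ P (gn_swap_meas hBm) (gn_swap_memLp hB) (KOc (σ.prod P) hWm hW f))⟫ =
    2 * ⟪f, lam • f + TKc κ P hAm hA f + TKc κ P hBm hB (KOc (σ.prod P) hWm hW f)⟫ := by
  have a1 : ⟪f, TKc κ P (gn_swap_meas hAm) (gn_swap_memLp hA) f⟫ = ⟪f, TKc κ P hAm hA f⟫ := by
    rw [TKc_adj hAm hA, real_inner_comm]
  have a2 : ⟪f, TKc κ P (gn_swap_meas hBm) (gn_swap_memLp hB) (KOc (σ.prod P) hWm hW f)⟫ =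
      ⟪f, TKc κ P hBm hB (KOc (σ.prod P) hWm hW f)⟫ := by
    have hs : ∀ g : Lp ℝ 2 (κ.prod (σ.prod P)),
        KOc (σ.prod P) (gn_swap_meas hWm) (gn_swap_memLp hW) g = KOc (σ.prod P) hWm hW g := by
      intro g
      apply Lp.ext
      filter_upwards [KOc_coe (ρ := σ.prod P) hWm hW g,
        KOc_coe (ρ := σ.prod P) (gn_swap_meas hWm) (gn_swap_memLp hW) g] with p h1 h2
      rw [h1, h2]
      simp only [KO, hWs]
    rw [real_inner_comm, ← TKc_adj hBm hB, real_inner_comm, KOc_adj, hs, gn_commc,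
      real_inner_comm]
  simp only [inner_add_right, inner_smul_right, a1, a2]
  ring

end TT

section FF
open scoped RealInnerProductSpace ENNReal

variable {Ω : Type} {mΩ : MeasurableSpace Ω} {P : Measure Ω} [IsProbabilityMeasure P] {T : ℝ}

theorem gn_rep {X : Type*} [MeasurableSpace X] {μ : Measure X} (f : Lp ℝ 2 μ) :
    ∃ (f0 : X → ℝ) (h : MemLp f0 2 μ), Measurable f0 ∧ h.toLp = f := by
  refine ⟨f, Lp.memLp f, (Lp.stronglyMeasurable f).measurable, Lp.toLp_coeFn f _⟩

theorem gn_posE {Atil : ℝ → ℝ → ℝ} (hA : IsL2Kernel T Atil)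
    (hApos : ∀ f : ℝ → ℝ, MemL2 T f → 0 ≤ ip T f (opK T Atil f))
    (f : Lp ℝ 2 ((volume.restrict (Icc (0:ℝ) T)).prod P)) :
    0 ≤ ⟪f, KOc P hA.1 (gn_ker hA) f⟫ := by
  obtain ⟨f0, hf, hm, rfl⟩ := gn_rep f
  rw [KOc_toLp, gn_inner_toLp, integral_prod_symm
    (fun p => f0 p * KO (volume.restrict (Icc (0:ℝ) T)) Atil f0 p)
    (hf.integrable_mul (KO_memLp hA.1 (gn_ker hA) hf))]
  apply integral_nonneg_of_ae
  filter_upwards [gn_memLp_left hf] with ω hω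
  exact hApos (fun t => f0 (t, ω)) ⟨hm.comp (by fun_prop), hω.integrable_sq⟩

theorem gn_graphon {W : ℝ → ℝ → ℝ} (hW : IsGraphon W) :
    MemLp (Function.uncurry W) 2
      ((volume.restrict (Icc (0:ℝ) 1)).prod (volume.restrict (Icc (0:ℝ) 1))) := by
  refine MemLp.of_bound hW.1.aestronglyMeasurable 1 (Eventually.of_forall ?_)
  rintro ⟨u, v⟩
  have := hW.2.2 u v
  rw [Real.norm_eq_abs, abs_le]
  constructor <;> simp only [Function.uncurry] <;> linarith [this.1, this.2]

theorem gn_coerc {Atil Btil W : ℝ → ℝ → ℝ} {lam cW : ℝ} (hA : IsL2Kernel T Atil)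
    (hB : IsL2Kernel T Btil) (hW : IsGraphon W)
    (hcoerc : ∀ g : ℝ → ℝ → ℝ, MemL2TI T g →
      cW * (∫ u in Icc (0:ℝ) 1, ∫ t in Icc (0:ℝ) T, (g t u) ^ 2) ≤
        ∫ u in Icc (0:ℝ) 1, ∫ t in Icc (0:ℝ) T,
          g t u * (lam * g t u + opK T Atil (fun s => g s u) t
            + opK T Btil (fun s => ∫ v in Icc (0:ℝ) 1, W u v * g s v) t))
    (f : Lp ℝ 2 ((volume.restrict (Icc (0:ℝ) 1)).prod ((volume.restrict (Icc (0:ℝ) T)).prod P))) :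
    cW * ⟪f, f⟫ ≤ ⟪f, lam • f + TKc _ P hA.1 (gn_ker hA) f
      + TKc _ P hB.1 (gn_ker hB) (KOc _ hW.1 (gn_graphon hW) f)⟫ := by
  obtain ⟨f0, hf, hm, rfl⟩ := gn_rep f
  have k1 := TK_memLp hA.1 (gn_ker hA) hf
  have k2 := KO_memLp hW.1 (gn_graphon hW) hf
  have k3 := TK_memLp hB.1 (gn_ker hB) k2
  have k0 := hf.const_smul lam
  rw [TKc_toLp, KOc_toLp, TKc_toLp, ← MemLp.toLp_const_smul, ← MemLp.toLp_add k0 k1,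
    ← MemLp.toLp_add (k0.add k1) k3, gn_inner_toLp, gn_inner_toLp]
  obtain ⟨i1, e1⟩ := gn_fub3 (hf.integrable_mul hf)
  obtain ⟨i2, e2⟩ := gn_fub3 (hf.integrable_mul ((k0.add k1).add k3))
  refine (congrArg (fun x => cW * x) e1).le.trans ((?_ : _ ≤ _).trans e2.ge)
  beta_reduce
  rw [← integral_const_mul]
  refine integral_mono_ae (i1.const_mul _) i2 ?_
  filter_upwards [gn_sec3 hf] with ω hω
  have hg : MemL2TI T (fun t u => f0 (u, (t, ω))) := by
    refine ⟨hm.comp (by fun_prop), ?_⟩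
    exact (hω.comp_measurePreserving Measure.measurePreserving_swap).integrable_sq
  have := hcoerc _ hg
  simp only [sq] at this
  exact this

end FF

section GG
open scoped RealInnerProductSpace ENNReal

variable {Ω : Type} {mΩ : MeasurableSpace Ω} {P : Measure Ω} [IsProbabilityMeasure P] {T : ℝ}

/-- Lebesgue measure on `[0,T]`. -/
abbrev gT (T : ℝ) : Measure ℝ := volume.restrict (Icc (0:ℝ) T)

/-- First-order condition map. -/
def MF (T : ℝ) (A B W : ℝ → ℝ → ℝ) (lam : ℝ) (f : ℝ × (ℝ × Ω) → ℝ) : ℝ × (ℝ × Ω) → ℝ :=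
  (2 * lam) • f + TK (gT T) A f + TK (gT T) (fun t s => A s t) f
    + (TK (gT T) B (KO (gT 1) W f) + TK (gT T) (fun t s => B s t) (KO (gT 1) W f))

/-- First-order condition operator. -/
def Mop (P : Measure Ω) [IsProbabilityMeasure P] {A B W : ℝ → ℝ → ℝ} (lam : ℝ)
    (hA : IsL2Kernel T A) (hB : IsL2Kernel T B) (hW : IsGraphon W) :
    Lp ℝ 2 ((gT 1).prod ((gT T).prod P)) →L[ℝ] Lp ℝ 2 ((gT 1).prod ((gT T).prod P)) :=
  (2 * lam) • ContinuousLinearMap.id ℝ _ + TKc (gT 1) P hA.1 (gn_ker hA)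
    + TKc (gT 1) P (gn_swap_meas hA.1) (gn_swap_memLp (gn_ker hA))
    + (TKc (gT 1) P hB.1 (gn_ker hB)
      + TKc (gT 1) P (gn_swap_meas hB.1) (gn_swap_memLp (gn_ker hB))) ∘L
        KOc ((gT T).prod P) hW.1 (gn_graphon hW)

variable {A B C W : ℝ → ℝ → ℝ} {lam cW : ℝ}

theorem MF_memLp (hA : IsL2Kernel T A) (hB : IsL2Kernel T B) (hW : IsGraphon W)
    {f : ℝ × (ℝ × Ω) → ℝ} (hf : MemLp f 2 ((gT 1).prod ((gT T).prod P))) :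
    MemLp (MF T A B W lam f) 2 ((gT 1).prod ((gT T).prod P)) := by
  have k1 := TK_memLp hA.1 (gn_ker hA) hf
  have k1' := TK_memLp (gn_swap_meas hA.1) (gn_swap_memLp (gn_ker hA)) hf
  have k2 := KO_memLp hW.1 (gn_graphon hW) hf
  have k3 := TK_memLp hB.1 (gn_ker hB) k2
  have k3' := TK_memLp (gn_swap_meas hB.1) (gn_swap_memLp (gn_ker hB)) k2
  have k0 := hf.const_smul (2 * lam)
  exact ((k0.add k1).add k1').add (k3.add k3')

theorem Mop_toLp (hA : IsL2Kernel T A) (hB : IsL2Kernel T B) (hW : IsGraphon W)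
    {f : ℝ × (ℝ × Ω) → ℝ} (hf : MemLp f 2 ((gT 1).prod ((gT T).prod P))) :
    Mop P lam hA hB hW hf.toLp = (MF_memLp (lam := lam) hA hB hW hf).toLp := by
  have k1 := TK_memLp hA.1 (gn_ker hA) hf
  have k1' := TK_memLp (gn_swap_meas hA.1) (gn_swap_memLp (gn_ker hA)) hf
  have k2 := KO_memLp hW.1 (gn_graphon hW) hf
  have k3 := TK_memLp hB.1 (gn_ker hB) k2
  have k3' := TK_memLp (gn_swap_meas hB.1) (gn_swap_memLp (gn_ker hB)) k2
  have k0 := hf.const_smul (2 * lam)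
  have e : Mop P lam hA hB hW hf.toLp = (2 * lam) • hf.toLp
    + TKc (gT 1) P hA.1 (gn_ker hA) hf.toLp
    + TKc (gT 1) P (gn_swap_meas hA.1) (gn_swap_memLp (gn_ker hA)) hf.toLp
    + (TKc (gT 1) P hB.1 (gn_ker hB) (KOc ((gT T).prod P) hW.1 (gn_graphon hW) hf.toLp)
      + TKc (gT 1) P (gn_swap_meas hB.1) (gn_swap_memLp (gn_ker hB))
        (KOc ((gT T).prod P) hW.1 (gn_graphon hW) hf.toLp)) := rfl
  rw [e, KOc_toLp, TKc_toLp, TKc_toLp, TKc_toLp, TKc_toLp, ← MemLp.toLp_const_smul]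
  rfl

theorem Mop_coerc (hA : IsL2Kernel T A) (hB : IsL2Kernel T B) (hW : IsGraphon W)
    (hcoerc : ∀ g : ℝ → ℝ → ℝ, MemL2TI T g →
      cW * (∫ u in Icc (0:ℝ) 1, ∫ t in Icc (0:ℝ) T, (g t u) ^ 2) ≤
        ∫ u in Icc (0:ℝ) 1, ∫ t in Icc (0:ℝ) T,
          g t u * (lam * g t u + opK T A (fun s => g s u) t
            + opK T B (fun s => ∫ v in Icc (0:ℝ) 1, W u v * g s v) t))
    (f : Lp ℝ 2 ((gT 1).prod ((gT T).prod P))) :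
    (2 * cW) * ⟪f, f⟫ ≤ ⟪f, Mop P lam hA hB hW f⟫ := by
  have h1 := gn_coerc hA hB hW hcoerc f
  have h2 := gn_symm_inner hW.1 (gn_graphon hW) hW.2.1 hA.1 (gn_ker hA) hB.1 (gn_ker hB) lam f
  have e : ⟪f, Mop P lam hA hB hW f⟫ = _ := h2
  rw [e]
  linarith

theorem gn_foc {F : Filtration ℝ mΩ} (hA : IsL2Kernel T A) (hB : IsL2Kernel T B)
    (hC : IsL2Kernel T C)
    (hlam : 0 < lam) (b : ℝ → ℝ → Ω → ℝ) (bstar : ℝ → Ω → ℝ) (c : ℝ → Ω → ℝ)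
    (hApos : ∀ f : ℝ → ℝ, MemL2 T f → 0 ≤ ip T f (opK T A f))
    (u : ℝ) (α : ℝ → ℝ → Ω → ℝ) (hprog : ProgMeasurable F (α u))
    (hα : MemLp (fun x : ℝ × Ω => α u x.1 x.2) 2 ((gT T).prod P))
    (hz : MemLp (fun x : ℝ × Ω => KO (gT 1) W (fun q : ℝ × (ℝ × Ω) => α q.1 q.2.1 q.2.2) (u, x)) 2
      ((gT T).prod P))
    (hb : MemLp (fun x : ℝ × Ω => b u x.1 x.2) 2 ((gT T).prod P))
    (hbs : MemLp (fun x : ℝ × Ω => bstar x.1 x.2) 2 ((gT T).prod P))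
    (hc : Integrable (c u) P) :
    (∀ β : ℝ → Ω → ℝ, ProgMeasurable F β → SqInt T P β →
        Jgr T P A B C lam W b bstar c u (Function.update α u β)
          ≤ Jgr T P A B C lam W b bstar c u α) ↔
    ∀ g : ℝ × Ω → ℝ, StronglyMeasurable[progS F] g → MemLp g 2 ((gT T).prod P) →
      ∫ x, g x * (MF T A B W lam (fun q : ℝ × (ℝ × Ω) => α q.1 q.2.1 q.2.2) (u, x)
        - b u x.1 x.2) ∂((gT T).prod P) = 0 := by
  set z : ℝ × Ω → ℝ :=
    fun x => KO (gT 1) W (fun q : ℝ × (ℝ × Ω) => α q.1 q.2.1 q.2.2) (u, x) with hzd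
  have hzdef : z = fun p => ∫ v in Icc (0:ℝ) 1, W u v * α v p.1 p.2 := rfl
  have hJ := fun β hβ => gn_J (P := P) A B C hA hB hC lam W b bstar c u α β z hzdef hz hb hbs hc hβ
  have hJα := hJ (α u) hα
  rw [Function.update_eq_self] at hJα
  set w := hb.toLp - (KOc P hB.1 (gn_ker hB) hz.toLp +
          KOc P (gn_swap_meas hB.1) (gn_swap_memLp (gn_ker hB)) hz.toLp) with hw
  have hU : hα.toLp ∈ lpMeas ℝ ℝ (progS F) 2 ((gT T).prod P) := by
    rw [mem_lpMeas_iff_aestronglyMeasurable]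
    exact ⟨_, (progS_iff F _).1 hprog, hα.coeFn_toLp⟩
  have key := gn_opt (KOc P hA.1 (gn_ker hA))
    (KOc P (gn_swap_meas hA.1) (gn_swap_memLp (gn_ker hA))) (KOc_adj hA.1 (gn_ker hA))
    (gn_posE hA hApos) hlam w hα.toLp (lpMeas ℝ ℝ (progS F) 2 ((gT T).prod P)) hU
  -- identification of the two sides
  have k1 := KO_memLp hA.1 (gn_ker hA) hα
  have k1' := KO_memLp (gn_swap_meas hA.1) (gn_swap_memLp (gn_ker hA)) hα
  have k3 := KO_memLp hB.1 (gn_ker hB) hz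
  have k3' := KO_memLp (gn_swap_meas hB.1) (gn_swap_memLp (gn_ker hB)) hz
  have k0 := hα.const_smul (2 * lam)
  have hΦ := ((k0.add k1).add k1').sub (hb.sub (k3.add k3'))
  have hΦe : (2 * lam) • hα.toLp + KOc P hA.1 (gn_ker hA) hα.toLp
    + KOc P (gn_swap_meas hA.1) (gn_swap_memLp (gn_ker hA)) hα.toLp - w = hΦ.toLp := by
    rw [hw, KOc_toLp, KOc_toLp, KOc_toLp, KOc_toLp]
    rfl
  have hin : ∀ (g : ℝ × Ω → ℝ) (hg : MemLp g 2 ((gT T).prod P)),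
      ⟪hg.toLp, hΦ.toLp⟫ =
      ∫ x, g x * (MF T A B W lam (fun q : ℝ × (ℝ × Ω) => α q.1 q.2.1 q.2.2) (u, x)
        - b u x.1 x.2) ∂((gT T).prod P) := by
    intro g hg
    rw [gn_inner_toLp]
    congr 1
    ext x
    congr 1
    have : MF T A B W lam (fun q : ℝ × (ℝ × Ω) => α q.1 q.2.1 q.2.2) (u, x) =
      2 * lam * α u x.1 x.2 + KO (gT T) A (fun x => α u x.1 x.2) x
        + KO (gT T) (fun t s => A s t) (fun x => α u x.1 x.2) x
        + (KO (gT T) B z x + KO (gT T) (fun t s => B s t) z x) := rfl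
    rw [this]
    simp only [Pi.add_apply, Pi.sub_apply, Pi.smul_apply, smul_eq_mul]
    ring
  rw [hΦe] at key
  have hrepr : ∀ g ∈ lpMeas ℝ ℝ (progS F) 2 ((gT T).prod P), ∃ (g0 : ℝ × Ω → ℝ)
      (h : MemLp g0 2 ((gT T).prod P)), StronglyMeasurable[progS F] g0 ∧ h.toLp = g := by
    intro g hg
    rw [mem_lpMeas_iff_aestronglyMeasurable] at hg
    obtain ⟨g0, h0, he⟩ := hg
    have hm : MemLp g0 2 ((gT T).prod P) := (memLp_congr_ae he).1 (Lp.memLp g)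
    refine ⟨g0, hm, h0, ?_⟩
    apply Lp.ext
    exact hm.coeFn_toLp.trans he.symm
  constructor
  · intro hN g hg hgm
    rw [← hin g hgm]
    refine key.1 ?_ _ ?_
    · intro g' hg'
      obtain ⟨g0, hm0, h0, rfl⟩ := hrepr g' hg'
      have h1 := hN (Function.curry g0) ((progS_iff F _).2 (by simpa using h0)) hm0.integrable_sq
      rw [hJα, hJ (Function.curry g0) hm0] at h1
      have := (add_le_add_iff_right _).1 h1
      exact this
    · rw [mem_lpMeas_iff_aestronglyMeasurable]
      exact ⟨_, hg, hgm.coeFn_toLp⟩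
  · intro hN β hβp hβs
    have hβm : MemLp (Function.uncurry β) 2 ((gT T).prod P) :=
      (memLp_two_iff_integrable_sq
        (((progS_iff F _).1 hβp).mono (progS_le F)).aestronglyMeasurable).2 hβs
    rw [hJα, hJ β hβm]
    refine add_le_add_left (key.2 ?_ _ ?_) _
    · intro g' hg'
      obtain ⟨g0, hm0, h0, rfl⟩ := hrepr g' hg'
      rw [hin g0 hm0]
      exact hN g0 h0 hm0
    · rw [mem_lpMeas_iff_aestronglyMeasurable]
      exact ⟨_, (progS_iff F _).1 hβp, hβm.coeFn_toLp⟩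

end GG

/-- Product of the Borel and the progressive σ-algebra. -/
def gnm2 {Ω : Type} {mΩ : MeasurableSpace Ω} (F : Filtration ℝ mΩ) :
    MeasurableSpace (ℝ × (ℝ × Ω)) := @Prod.instMeasurableSpace ℝ (ℝ × Ω) _ (progS F)

theorem gnm2_le {Ω : Type} {mΩ : MeasurableSpace Ω} (F : Filtration ℝ mΩ) :
    gnm2 F ≤ (Prod.instMeasurableSpace : MeasurableSpace (ℝ × (ℝ × Ω))) :=
  sup_le_sup le_rfl (MeasurableSpace.comap_mono (progS_le F))

theorem gn_sec_sm {X : Type*} {m : MeasurableSpace X} {f : ℝ × X → ℝ}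
    (hf : StronglyMeasurable f) (u : ℝ) : StronglyMeasurable (fun x => f (u, x)) :=
  hf.comp_measurable measurable_prodMk_left

theorem gn_tens_sm {X : Type*} {m : MeasurableSpace X} {B : Set ℝ} (hB : MeasurableSet B)
    {g : X → ℝ} (hg : StronglyMeasurable g) :
    StronglyMeasurable (fun p : ℝ × X => B.indicator (fun _ => (1:ℝ)) p.1 * g p.2) :=
  (((stronglyMeasurable_const (b := (1:ℝ))).indicator hB).comp_measurable measurable_fst).mul
    (hg.comp_measurable measurable_snd)

theorem gn_sub_sm {X : Type*} {m : MeasurableSpace X} {f g : X → ℝ}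
    (hf : StronglyMeasurable f) (hg : StronglyMeasurable g) :
    StronglyMeasurable (fun x => f x - g x) := hf.sub hg

/-- Under Assumptions (G3) and (G4), the graphon game admits a Nash
equilibrium, unique up to `dℙ⊗dt⊗du`-a.e. equality. -/
theorem graphon_nash_exists_unique
    {Ω : Type} {mΩ : MeasurableSpace Ω} (P : Measure Ω) [IsProbabilityMeasure P]
    (F : Filtration ℝ mΩ) (T : ℝ) (hT : 0 < T)
    (Atil Btil Ctil : ℝ → ℝ → ℝ)
    (hA : IsVolterraKernel T Atil) (hBk : IsVolterraKernel T Btil)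
    (hCk : IsVolterraKernel T Ctil)
    (hsup : ∃ Cs : ℝ, ∀ t ∈ Icc (0:ℝ) T,
      (∫ s in Icc (0:ℝ) T, ((Atil t s) ^ 2 + (Btil t s) ^ 2)) ≤ Cs ∧
        (∫ s in Icc (0:ℝ) T, ((Atil s t) ^ 2 + (Btil s t) ^ 2)) ≤ Cs)
    (lam : ℝ) (hlam : 0 < lam)
    (W : ℝ → ℝ → ℝ) (hW : IsGraphon W)
    (b : ℝ → ℝ → Ω → ℝ)
    (hbmeas : Measurable fun q : ℝ × ℝ × Ω => b q.1 q.2.1 q.2.2)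
    (hbL2 : Integrable (fun q : ℝ × ℝ × Ω => (b q.1 q.2.1 q.2.2) ^ 2)
      ((volume.restrict (Icc (0:ℝ) 1)).prod ((volume.restrict (Icc (0:ℝ) T)).prod P)))
    (hbprog : ∀ᵐ u ∂(volume.restrict (Icc (0:ℝ) 1)), ProgMeasurable F (b u))
    (bstar : ℝ → Ω → ℝ) (hbstar : ProgMeasurable F bstar ∧ SqInt T P bstar)
    (c : ℝ → Ω → ℝ) (hc : ∀ u, Integrable (c u) P ∧ Measurable[F T] (c u))
    -- Assumption (G4)
    (hApos : ∀ f : ℝ → ℝ, MemL2 T f → 0 ≤ ip T f (opK T Atil f))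
    (cW : ℝ) (hcW : 0 < cW)
    (hcoerc : ∀ g : ℝ → ℝ → ℝ, MemL2TI T g →
      cW * (∫ u in Icc (0:ℝ) 1, ∫ t in Icc (0:ℝ) T, (g t u) ^ 2) ≤
        ∫ u in Icc (0:ℝ) 1, ∫ t in Icc (0:ℝ) T,
          g t u * (lam * g t u + opK T Atil (fun s => g s u) t
            + opK T Btil (fun s => ∫ v in Icc (0:ℝ) 1, W u v * g s v) t))
 :
    ∃ αhat : ℝ → ℝ → Ω → ℝ,
      IsGraphonNash T F P Atil Btil Ctil lam W b bstar c αhat ∧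
        ∀ βhat : ℝ → ℝ → Ω → ℝ,
          IsGraphonNash T F P Atil Btil Ctil lam W b bstar c βhat →
          ∀ᵐ q ∂((volume.restrict (Icc (0:ℝ) 1)).prod
              ((volume.restrict (Icc (0:ℝ) T)).prod P)),
            αhat q.1 q.2.1 q.2.2 = βhat q.1 q.2.1 q.2.2 := by
  have hbm : MemLp (fun q : ℝ × (ℝ × Ω) => b q.1 q.2.1 q.2.2) 2 ((gT 1).prod ((gT T).prod P)) :=
    (memLp_two_iff_integrable_sq hbmeas.aestronglyMeasurable).2 hbL2
  have hbsm : MemLp (fun x : ℝ × Ω => bstar x.1 x.2) 2 ((gT T).prod P) :=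
    (memLp_two_iff_integrable_sq
      (((progS_iff F _).1 hbstar.1).mono (progS_le F)).aestronglyMeasurable).2 hbstar.2
  have hm2 := gnm2_le F
  have : Fact (gnm2 F ≤ (Prod.instMeasurableSpace : MeasurableSpace (ℝ × (ℝ × Ω)))) := ⟨hm2⟩
  obtain ⟨f, hfH, hf⟩ := gn_laxMilgram (Mop P lam hA.1 hBk.1 hW) (c := 2 * cW) (by linarith)
    (Mop_coerc hA.1 hBk.1 hW hcoerc) (lpMeas ℝ ℝ (gnm2 F) 2 ((gT 1).prod ((gT T).prod P))) hbm.toLp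
  rw [mem_lpMeas_iff_aestronglyMeasurable] at hfH
  obtain ⟨f0, hf0m, hf0e⟩ := hfH
  have hf0 : MemLp f0 2 ((gT 1).prod ((gT T).prod P)) := (memLp_congr_ae hf0e).1 (Lp.memLp f)
  have hff : f = hf0.toLp := Lp.ext (hf0e.trans hf0.coeFn_toLp.symm)
  subst hff
  have hsecprog : ∀ u, StronglyMeasurable[progS F] (fun x : ℝ × Ω => f0 (u, x)) := by
    intro u
    exact gn_sec_sm (m := progS F) hf0m u
  -- first-order conditions for general admissible profiles
  have hfoc : ∀ α : ℝ → ℝ → Ω → ℝ,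
      MemLp (fun q : ℝ × (ℝ × Ω) => α q.1 q.2.1 q.2.2) 2 ((gT 1).prod ((gT T).prod P)) →
      (∀ u ∈ Icc (0:ℝ) 1, ProgMeasurable F (α u)) →
      ∀ᵐ u ∂(gT 1), ((∀ β : ℝ → Ω → ℝ, ProgMeasurable F β → SqInt T P β →
        Jgr T P Atil Btil Ctil lam W b bstar c u (Function.update α u β)
          ≤ Jgr T P Atil Btil Ctil lam W b bstar c u α) ↔
        ∀ g : ℝ × Ω → ℝ, StronglyMeasurable[progS F] g → MemLp g 2 ((gT T).prod P) →
          ∫ x, g x * (MF T Atil Btil W lam (fun q : ℝ × (ℝ × Ω) => α q.1 q.2.1 q.2.2) (u, x)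
            - b u x.1 x.2) ∂((gT T).prod P) = 0) := by
    intro α hα hprog
    filter_upwards [gn_memLp_right hα, gn_memLp_right (KO_memLp hW.1 (gn_graphon hW) hα),
      gn_memLp_right hbm, ae_restrict_mem measurableSet_Icc] with u h1 h2 h3 h4
    exact gn_foc hA.1 hBk.1 hCk.1 hlam b bstar c hApos u α (hprog u h4) h1 h2 h3 hbsm (hc u).1
  have hsel : ∀ᵐ u ∂(gT 1), ∀ g : ℝ × Ω → ℝ, StronglyMeasurable[progS F] g →
      MemLp g 2 ((gT T).prod P) →
      ∫ x, g x * (MF T Atil Btil W lam f0 (u, x) - b u x.1 x.2) ∂((gT T).prod P) = 0 := by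
    have hΦ := (MF_memLp (lam := lam) hA.1 hBk.1 hW hf0).sub hbm
    refine gn_select (progS_le F) hΦ ?_
    intro S g hS hg hgm
    have ht : MemLp (fun p : ℝ × (ℝ × Ω) => S.indicator (fun _ => (1:ℝ)) p.1 * g p.2) 2
        ((gT 1).prod ((gT T).prod P)) :=
      gn_tensor ((memLp_const (1:ℝ)).indicator hS) hgm
    have h := hf ht.toLp (by
      rw [mem_lpMeas_iff_aestronglyMeasurable]
      exact ⟨_, gn_tens_sm (m := progS F) hS hg, ht.coeFn_toLp⟩)
    rw [Mop_toLp, ← MemLp.toLp_sub, gn_inner_toLp] at h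
    exact h
  refine ⟨fun u t ω => f0 (u, (t, ω)), ⟨⟨?_, ?_, ?_, ?_⟩, ?_⟩, ?_⟩
  · exact (hf0m.mono hm2).measurable
  · intro u _
    exact (progS_iff F _).2 (hsecprog u)
  · filter_upwards [gn_memLp_right hf0] with u hu
    exact hu.integrable_sq
  · exact hf0.integrable_sq
  · filter_upwards [hsel, hfoc (fun u t ω => f0 (u, (t, ω))) hf0
      (fun u _ => (progS_iff F _).2 (hsecprog u))] with u h1 h2
    exact h2.2 h1
  · rintro β ⟨⟨hβm, hβp, -, hβs⟩, hβN⟩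
    have hβ : MemLp (fun q : ℝ × (ℝ × Ω) => β q.1 q.2.1 q.2.2) 2
        ((gT 1).prod ((gT T).prod P)) :=
      (memLp_two_iff_integrable_sq hβm.aestronglyMeasurable).2 hβs
    have hMf := MF_memLp (lam := lam) hA.1 hBk.1 hW hf0
    have hMβ := MF_memLp (lam := lam) hA.1 hBk.1 hW hβ
    have hδ := hf0.sub hβ
    have hzero : inner ℝ (hf0.toLp - hβ.toLp)
        (Mop P lam hA.1 hBk.1 hW (hf0.toLp - hβ.toLp)) = 0 := by
      rw [map_sub, Mop_toLp, Mop_toLp, ← MemLp.toLp_sub, ← MemLp.toLp_sub, gn_inner_toLp]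
      have hintg := hδ.integrable_mul (hMf.sub hMβ)
      refine (integral_prod _ hintg).trans ?_
      apply integral_eq_zero_of_ae
      filter_upwards [hsel, hfoc β hβ hβp, hβN, gn_memLp_right hf0, gn_memLp_right hβ,
        gn_memLp_right (hMf.sub hbm), gn_memLp_right (hMβ.sub hbm),
        ae_restrict_mem measurableSet_Icc] with u h1 h2 h3 h4 h5 h6 h7 h8
      have hg : StronglyMeasurable[progS F] (fun x : ℝ × Ω => f0 (u, x) - β u x.1 x.2) :=
        gn_sub_sm (m := progS F) (hsecprog u) ((progS_iff F _).1 (hβp u h8))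
      have hgm : MemLp (fun x : ℝ × Ω => f0 (u, x) - β u x.1 x.2) 2 ((gT T).prod P) := h4.sub h5
      have e1 := h1 _ hg hgm
      have e2 := h2.1 h3 _ hg hgm
      have e3 := integral_sub (hgm.integrable_mul h6) (hgm.integrable_mul h7)
      simp only [Pi.mul_apply, Pi.sub_apply] at e3
      rw [e1, e2, sub_zero] at e3
      simp only [Pi.zero_apply, Pi.mul_apply, Pi.sub_apply]
      rw [← e3]
      congr 1
      ext x
      ring
    have hco := Mop_coerc (P := P) hA.1 hBk.1 hW hcoerc (hf0.toLp - hβ.toLp)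
    rw [hzero] at hco
    have h0 : inner ℝ (hf0.toLp - hβ.toLp) (hf0.toLp - hβ.toLp) ≤ 0 := by
      by_contra hcon
      push Not at hcon
      have := mul_pos (by linarith : (0:ℝ) < 2 * cW) hcon
      linarith
    rw [real_inner_self_nonpos, sub_eq_zero, MemLp.toLp_eq_toLp_iff] at h0
    exact h0
end
end
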